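/- arXiv:2206.06492 — 2 statements merged into one kernel-verified Lean document; each statement's English description precedes it below -/
import Mathlib

section
/- Let (S_⋆, Π_⋆) be (S, Π), (S_m, Π_sm), or (S_s, Π_ss) (Π the set of all policies, Π_sm the semi-Markov policies, Π_ss the semi-stationary policies), and let φ : tilde-S_⋆ → [−∞, +∞] be lower semianalytic. Then: (i) the function φ*(x) := inf over p ∈ tilde-S_⋆(x) of φ(x, p) is lower semianalytic on 𝕏; (ii) for each ε > 0 there exists a policy π* ∈ Π_⋆ such that φ(x, ρ_x[π*]) = φ*(x) for every x in E* := {x ∈ 𝕏 : the infimum defining φ*(x) is attained}, and for every x ∉ E*, φ(x, ρ_x[π*]) ≤ φ*(x) + ε if φ*(x) > −∞ and φ(x, ρ_x[π*]) ≤ −1/ε if φ*(x) = −∞. -/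
open MeasureTheory ProbabilityTheory Filter
open scoped ENNReal NNReal Topology

noncomputable section

namespace PaperStmt

/-- The Borel σ-algebra of the topology of weak convergence on the space of Borel
probability measures. -/
instance instMeasProb {Ω : Type*} [MeasurableSpace Ω] [TopologicalSpace Ω]
    [OpensMeasurableSpace Ω] : MeasurableSpace (ProbabilityMeasure Ω) := borel _

/-- A set is universally measurable if it is measurable with respect to the completion of
every Borel probability measure. -/
def UniversallyMeasurableSet {α : Type*} [MeasurableSpace α] (s : Set α) : Prop :=
  ∀ μ : Measure α, IsProbabilityMeasure μ → NullMeasurableSet s μ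

/-- A map between measurable spaces is universally measurable if preimages of measurable
sets are universally measurable. -/
def UniversallyMeasurable {α β : Type*} [MeasurableSpace α] [MeasurableSpace β]
    (f : α → β) : Prop :=
  ∀ s : Set β, MeasurableSet s → UniversallyMeasurableSet (f ⁻¹' s)

/-- A function into the extended reals is lower semianalytic if all its sublevel sets are
analytic. -/
def LowerSemianalytic {γ : Type*} [TopologicalSpace γ] (f : γ → EReal) : Prop :=
  ∀ r : ℝ, MeasureTheory.AnalyticSet {x | f x ≤ (r : EReal)}

/-- Lower semianalyticity on a given (analytic) domain. -/
def LowerSemianalyticOn {γ : Type*} [TopologicalSpace γ] (D : Set γ) (f : γ → EReal) : Prop :=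
  ∀ r : ℝ, MeasureTheory.AnalyticSet {x | x ∈ D ∧ f x ≤ (r : EReal)}

/-- Upper semianalyticity on a given (analytic) domain. -/
def UpperSemianalyticOn {γ : Type*} [TopologicalSpace γ] (D : Set γ) (f : γ → EReal) : Prop :=
  ∀ r : ℝ, MeasureTheory.AnalyticSet {x | x ∈ D ∧ (r : EReal) ≤ f x}

/-- The nonnegative part of an extended real number, as an element of `ℝ≥0∞`. -/
def ePos (y : EReal) : ℝ≥0∞ := if y = ⊤ then ⊤ else ENNReal.ofReal y.toReal

/-- The integral `∫ f⁺ dμ - ∫ f⁻ dμ` of an extended-real-valued function, with the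
convention `∞ - ∞ = ∞`. -/
def eint {γ : Type*} [MeasurableSpace γ] (μ : Measure γ) (f : γ → EReal) : EReal :=
  if (∫⁻ x, ePos (f x) ∂μ) = ⊤ then ⊤
  else ((∫⁻ x, ePos (f x) ∂μ : ℝ≥0∞) : EReal) - ((∫⁻ x, ePos (-f x) ∂μ : ℝ≥0∞) : EReal)

/-- Finite sums of extended reals, with the convention `∞ - ∞ = ∞`. -/
def esum {n : ℕ} (v : Fin n → EReal) : EReal :=
  if (∑ i, ePos (v i)) = ⊤ then ⊤
  else ((∑ i, ePos (v i) : ℝ≥0∞) : EReal) - ((∑ i, ePos (-v i) : ℝ≥0∞) : EReal)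

/-- The space `H_n = (𝕏 × 𝔸)ⁿ × 𝕏` of histories `h_n = (x_0,a_0,…,x_n)`. -/
abbrev Hist (X A : Type*) (n : ℕ) := (Fin n → X × A) × X

/-- The sample space `Ω = (𝕏 × 𝔸)^∞`. -/
abbrev Traj (X A : Type*) := ℕ → X × A

/-- The initial state `x_0` of a history. -/
def firstState {X A : Type*} : ∀ {n : ℕ}, Hist X A n → X
  | 0, h => h.2
  | _ + 1, h => (h.1 0).1

/-- A universally measurable policy for the MDP with control constraint `Acts`. -/
structure Policy {X A : Type*} [MeasurableSpace X] [MeasurableSpace A]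
    (Acts : X → Set A) where
  μ : ∀ n : ℕ, Hist X A n → Measure A
  isProb : ∀ n h, IsProbabilityMeasure (μ n h)
  umeas : ∀ (n : ℕ) (B : Set A), MeasurableSet B →
    UniversallyMeasurable fun h : Hist X A n => μ n h B
  feasible : ∀ n h, μ n h (Acts h.2) = 1

namespace Policy

variable {X A : Type*} [MeasurableSpace X] [MeasurableSpace A] {Acts : X → Set A}

/-- Nonrandomized policies: every decision is a Dirac measure. -/
def Nonrandomized (π : Policy Acts) : Prop :=
  ∀ n h, ∃ a : A, π.μ n h = Measure.dirac a

/-- Markov policies: the decision depends only on the current state. -/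
def Markov (π : Policy Acts) : Prop :=
  ∃ m : ℕ → X → Measure A, ∀ n h, π.μ n h = m n h.2

/-- Stationary policies. -/
def Stationary (π : Policy Acts) : Prop :=
  ∃ m : X → Measure A, ∀ n h, π.μ n h = m h.2

/-- Semi-Markov policies: the decision depends only on `(x_0, x_n)`. -/
def SemiMarkov (π : Policy Acts) : Prop :=
  ∃ m : ℕ → X × X → Measure A, ∀ n h, π.μ n h = m n (firstState h, h.2)

/-- Semi-stationary policies. -/
def SemiStationary (π : Policy Acts) : Prop :=
  ∃ m : X × X → Measure A, ∀ n h, π.μ n h = m (firstState h, h.2)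

end Policy

variable {X A : Type*} [MeasurableSpace X] [MeasurableSpace A]

/-- The iterated integral giving the finite-dimensional distributions of the process
induced by an initial distribution, the transition kernel and a policy. -/
def histInt (p0 : Measure X) (q : Kernel (X × A) X)
    (ν : ∀ n : ℕ, Hist X A n → Measure A) :
    ∀ n : ℕ, (Hist X A n → ℝ≥0∞) → ℝ≥0∞
  | 0, f => ∫⁻ x, f (Fin.elim0, x) ∂p0
  | n + 1, f => histInt p0 q ν n fun h =>
      ∫⁻ a, ∫⁻ y, f (Fin.snoc h.1 (h.2, a), y) ∂(q (h.2, a)) ∂(ν n h)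

/-- `Induces q π p0 p` says that `p` is (the restriction to the Borel σ-algebra of) the
strategic measure `ρ_{p0}[π]`, i.e. `p` has the finite-dimensional distributions generated
by `p0`, the policy `π`, and the transition kernel `q`. -/
def Induces (q : Kernel (X × A) X) {Acts : X → Set A} (π : Policy Acts)
    (p0 : Measure X) (p : Measure (Traj X A)) : Prop :=
  ∀ (n : ℕ) (B : Set (Hist X A n)), MeasurableSet B →
    p {ω : Traj X A | ((fun i : Fin n => ω i.val), (ω n).1) ∈ B}
      = histInt p0 q π.μ n (B.indicator fun _ => 1)

/-- The set of strategic measures induced by policies in the class `C` (over all initial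
distributions). -/
def SOf (q : Kernel (X × A) X) (Acts : X → Set A) (C : Policy Acts → Prop) :
    Set (ProbabilityMeasure (Traj X A)) :=
  {p | ∃ (π : Policy Acts) (p0 : ProbabilityMeasure X),
    C π ∧ Induces q π p0.toMeasure p.toMeasure}

variable [TopologicalSpace X] [BorelSpace X] [TopologicalSpace A] [BorelSpace A]

/-- The section `tilde-S_⋆(x)`: strategic measures in the class with initial distribution `δ_x`. -/
def tsec (q : Kernel (X × A) X) (Acts : X → Set A) (C : Policy Acts → Prop) (x : X) :
    Set (ProbabilityMeasure (Traj X A)) :=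
  {p | p ∈ SOf q Acts C ∧ p.toMeasure.map (fun ω => (ω 0).1) = Measure.dirac x}

/-- The set `tilde-S_⋆ ⊂ 𝕏 × P(Ω)`. -/
def tset (q : Kernel (X × A) X) (Acts : X → Set A) (C : Policy Acts → Prop) :
    Set (X × ProbabilityMeasure (Traj X A)) :=
  {xp | xp.2 ∈ tsec q Acts C xp.1}

end PaperStmt

namespace PaperStmt

variable {X A : Type*} [TopologicalSpace X] [PolishSpace X] [MeasurableSpace X] [BorelSpace X]
  [TopologicalSpace A] [PolishSpace A] [MeasurableSpace A] [BorelSpace A]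

/-- The optimal value `φ*(x) = inf_{p ∈ tilde-S_⋆(x)} φ(x,p)` of the optimization problem
on strategic measures. -/
def phiStar (q : Kernel (X × A) X) (Acts : X → Set A) (C : Policy Acts → Prop)
    (φ : X × ProbabilityMeasure (Traj X A) → EReal) (x : X) : EReal :=
  ⨅ p ∈ tsec q Acts C x, φ (x, p)

/-- The conclusion of Theorem `thm-opt` (i)-(ii) for a class of policies `CPol` whose
strategic measures (with Dirac initial distributions) form the sections `tsec q Acts C`. -/
def OptConclusion (q : Kernel (X × A) X) (Acts : X → Set A) (C : Policy Acts → Prop)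
    (CPol : Policy Acts → Prop) (φ : X × ProbabilityMeasure (Traj X A) → EReal) : Prop :=
  -- (i) `φ*` is lower semianalytic
  LowerSemianalytic (phiStar q Acts C φ) ∧
  -- (ii) for each `ε > 0` there is an `ε`-optimal policy in the class, exactly optimal at
  -- every state where the infimum is attained
  ∀ ε : ℝ, 0 < ε →
    ∃ (π : Policy Acts) (R : X → ProbabilityMeasure (Traj X A)),
      CPol π ∧ (∀ x, Induces q π (Measure.dirac x) (R x).toMeasure) ∧
      (∀ x, (∃ p ∈ tsec q Acts C x, φ (x, p) = phiStar q Acts C φ x) →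
        φ (x, R x) = phiStar q Acts C φ x) ∧
      (∀ x, ¬ (∃ p ∈ tsec q Acts C x, φ (x, p) = phiStar q Acts C φ x) →
        (phiStar q Acts C φ x ≠ ⊥ → φ (x, R x) ≤ phiStar q Acts C φ x + (ε : EReal)) ∧
        (phiStar q Acts C φ x = ⊥ → φ (x, R x) ≤ ((-ε⁻¹ : ℝ) : EReal)))

end PaperStmt

namespace PaperStmt

section UniversalMeasurability

/-- The σ-algebra of universally measurable sets. -/
@[reducible] def um (α : Type*) [MeasurableSpace α] : MeasurableSpace α where
  MeasurableSet' s := UniversallyMeasurableSet s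
  measurableSet_empty := fun _ _ => MeasurableSet.empty.nullMeasurableSet
  measurableSet_compl := fun _ hs μ hμ => (hs μ hμ).compl
  measurableSet_iUnion := fun _ hs μ hμ => NullMeasurableSet.iUnion fun i => hs i μ hμ

variable {α β γ : Type*} [MeasurableSpace α] [MeasurableSpace β] [MeasurableSpace γ]

lemma le_um : ‹MeasurableSpace α› ≤ um α :=
  fun _ hs _ _ => MeasurableSet.nullMeasurableSet hs

lemma measurable_um {f : α → β} (hf : Measurable f) : Measurable[um α] f :=
  hf.mono le_um le_rfl

lemma nullMeasurable_of_um {f : α → β} (hf : Measurable[um α] f) (μ : Measure α)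
    [IsProbabilityMeasure μ] : NullMeasurable f μ :=
  fun _ hs => hf hs μ inferInstance

lemma aemeasurable_of_um [MeasurableSpace.CountablyGenerated β] {f : α → β}
    (hf : Measurable[um α] f) (μ : Measure α) [IsProbabilityMeasure μ] : AEMeasurable f μ :=
  (nullMeasurable_of_um hf μ).aemeasurable

lemma measurable_um_of_aemeasurable {f : α → β}
    (hf : ∀ μ : Measure α, IsProbabilityMeasure μ → AEMeasurable f μ) : Measurable[um α] f :=
  fun _ hs μ hμ => (hf μ hμ).nullMeasurable hs

/-- Universally measurable maps are measurable for the universal σ-algebra on the target. -/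
lemma measurable_um_um {f : α → β} (hf : Measurable[um α] f) : Measurable[um α, um β] f := by
  intro s hs μ hμ
  let f' : NullMeasurableSpace α μ → β := f
  have hf' : Measurable f' := fun _ ht => hf ht μ hμ
  have hprob : IsProbabilityMeasure (μ.completion.map f') := by
    constructor
    rw [Measure.map_apply hf' MeasurableSet.univ]
    exact (Measure.completion_apply μ _).trans measure_univ
  obtain ⟨t, ht, hst⟩ := hs _ hprob
  have h1 : NullMeasurableSet (f ⁻¹' t) μ := hf ht μ hμ
  refine h1.congr ?_
  have h2 : ∀ᵐ x ∂μ.completion.map f', (x ∈ s) = (x ∈ t) := hst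
  have h3 := ae_of_ae_map (μ := μ.completion) hf'.aemeasurable h2
  have h4 : ∀ᵐ x ∂μ, (f x ∈ s) = (f x ∈ t) := by
    rw [ae_iff] at h3 ⊢
    exact (Measure.completion_apply μ _).symm.trans h3
  exact h4.mono fun x hx => hx.symm

lemma measurable_um_comp {g : β → γ} {f : α → β} (hg : Measurable[um β] g)
    (hf : Measurable[um α] f) : Measurable[um α] (fun x => g (f x)) :=
  hg.comp (measurable_um_um hf)

end UniversalMeasurability

section Analytic

variable {α : Type*} [TopologicalSpace α] [PolishSpace α] [MeasurableSpace α] [BorelSpace α]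

lemma exists_isCompact_of_lt_measure_range (μ : Measure α) [IsFiniteMeasure μ]
    {f : (ℕ → ℕ) → α} (hf : Continuous f) {c : ℝ≥0∞} (hc : c < μ (Set.range f)) :
    ∃ K ⊆ Set.range f, IsCompact K ∧ c ≤ μ K := by
  have step : ∀ (n : ℕ) (S : {S : Set (ℕ → ℕ) // c < μ (f '' S)}),
      ∃ m : ℕ, c < μ (f '' (S.1 ∩ {s | s n ≤ m})) := by
    intro n S
    have hmono : Monotone fun m : ℕ => f '' (S.1 ∩ {s | s n ≤ m}) := fun a b hab =>
      Set.image_mono fun s hs => ⟨hs.1, le_trans hs.2 hab⟩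
    have hU : f '' S.1 = ⋃ m : ℕ, f '' (S.1 ∩ {s | s n ≤ m}) := by
      rw [← Set.image_iUnion, ← Set.inter_iUnion]
      congr 1
      ext s
      simp only [Set.mem_inter_iff, Set.mem_iUnion, Set.mem_ofPred_eq]
      exact ⟨fun h => ⟨h, s n, le_rfl⟩, fun h => h.1⟩
    have h2 := S.2
    rw [hU, hmono.measure_iUnion] at h2
    exact lt_iSup_iff.1 h2
  choose m hm using step
  let S : ℕ → {S : Set (ℕ → ℕ) // c < μ (f '' S)} := fun n =>
    Nat.rec ⟨Set.univ, by rwa [Set.image_univ]⟩ (fun n S => ⟨S.1 ∩ {s | s n ≤ m n S}, hm n S⟩) n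
  let k : ℕ → ℕ := fun n => m n (S n)
  have hS : ∀ n, (S n).1 = {s | ∀ i < n, s i ≤ k i} := by
    intro n
    induction n with
    | zero => ext s; simp [S]
    | succ n ih =>
      have : (S (n + 1)).1 = (S n).1 ∩ {s | s n ≤ k n} := rfl
      rw [this, ih]
      ext s
      simp only [Set.mem_inter_iff, Set.mem_ofPred_eq]
      constructor
      · intro h i hi
        rcases (Nat.lt_succ_iff.1 hi).lt_or_eq with h' | rfl
        exacts [h.1 i h', h.2]
      · intro h
        exact ⟨fun i hi => h i (hi.trans n.lt_succ_self), h n n.lt_succ_self⟩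
  let K : Set (ℕ → ℕ) := Set.pi Set.univ fun i => Set.Iic (k i)
  have hK : IsCompact K := isCompact_univ_pi fun i => (Set.finite_Iic _).isCompact
  refine ⟨f '' K, Set.image_subset_range _ _, hK.image hf, ?_⟩
  rw [Set.measure_eq_iInf_isOpen]
  refine le_iInf₂ fun U hU => le_iInf fun hUo => ?_
  suffices h : ∃ n, f '' (S n).1 ⊆ U by
    obtain ⟨n, hn⟩ := h
    exact (S n).2.le.trans (measure_mono hn)
  by_contra! hcon
  have hex : ∀ n, ∃ t, (∀ i < n, t i ≤ k i) ∧ f t ∉ U := by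
    intro n
    obtain ⟨_, ⟨t, ht, rfl⟩, htU⟩ := Set.not_subset.1 (hcon n)
    rw [hS] at ht
    exact ⟨t, ht, htU⟩
  choose t ht htU using hex
  let t' : ℕ → ℕ → ℕ := fun n i => if i < n then t n i else 0
  have ht' : ∀ n, t' n ∈ K := by
    intro n i _
    by_cases h : i < n <;> simp [t', h, ht]
  obtain ⟨s, hsK, φ, hφ, hlim⟩ := hK.tendsto_subseq ht'
  have hlim2 : Tendsto (fun j => t (φ j)) atTop (𝓝 s) := by
    rw [tendsto_pi_nhds] at hlim ⊢
    intro i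
    refine (hlim i).congr' ?_
    filter_upwards [eventually_gt_atTop i] with j hj
    have : i < φ j := hj.trans_le (hφ.id_le j)
    simp [t', this]
  have hsU : f ⁻¹' U ∈ 𝓝 s :=
    (hUo.preimage hf).mem_nhds (hU ⟨s, hsK, rfl⟩)
  obtain ⟨j, hj⟩ := (hlim2.eventually hsU).exists
  exact htU _ hj

/-- Analytic subsets of a Polish space are universally measurable. -/
lemma AnalyticSet.measurableSet_um {s : Set α} (hs : AnalyticSet s) : MeasurableSet[um α] s := by
  intro μ hμ
  rw [AnalyticSet] at hs
  rcases hs with rfl | ⟨f, hf, rfl⟩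
  · exact MeasurableSet.empty.nullMeasurableSet
  by_cases h0 : μ (Set.range f) = 0
  · exact NullMeasurableSet.of_null h0
  obtain ⟨u, -, hu, hlim⟩ := exists_seq_strictMono_tendsto' (pos_iff_ne_zero.2 h0)
  choose K hKs hKc hKu using fun n => exists_isCompact_of_lt_measure_range μ hf (hu n).2
  have hB : MeasurableSet (⋃ n, K n) := .iUnion fun n => (hKc n).measurableSet
  have hBs : (⋃ n, K n) ⊆ Set.range f := Set.iUnion_subset hKs
  have hle : μ (Set.range f) ≤ μ (⋃ n, K n) :=
    le_of_tendsto' hlim fun n => (hKu n).trans (measure_mono (Set.subset_iUnion _ _))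
  have hae : (⋃ n, K n) =ᵐ[μ] toMeasurable μ (Set.range f) :=
    ae_eq_of_subset_of_measure_ge (hBs.trans (subset_toMeasurable _ _))
      (by rwa [measure_toMeasurable]) hB.nullMeasurableSet (measure_ne_top _ _)
  refine hB.nullMeasurableSet.congr ?_
  rw [ae_eq_set] at hae ⊢
  refine ⟨by rw [Set.sdiff_eq_empty.2 hBs, measure_empty], ?_⟩
  exact measure_mono_null (Set.sdiff_subset_sdiff_left (subset_toMeasurable _ _)) hae.2

/-- Universally measurable right inverses of continuous maps on the Baire space. -/
lemma exists_um_rightInverse {g : (ℕ → ℕ) → α} (hg : Continuous g) :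
    ∃ s : α → (ℕ → ℕ), Measurable[um α] s ∧ ∀ x ∈ Set.range g, g (s x) = x := by
  let C : ℕ → List ℕ → ℕ → Set α := fun n l k =>
    g '' {u | (List.range n).map u = l ∧ u n = k}
  have hC : ∀ n l k, MeasurableSet[um α] (C n l k) := by
    intro n l k
    refine AnalyticSet.measurableSet_um ?_
    refine AnalyticSet.image_of_continuous (IsClosed.analyticSet ?_) hg
    have h1 : IsClosed {u : ℕ → ℕ | u n = k} :=
      isClosed_eq (continuous_apply n) continuous_const
    have h2 : ∀ (L : List ℕ) (l : List ℕ), IsClosed {u : ℕ → ℕ | L.map u = l} := by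
      intro L
      induction L with
      | nil => intro l; simp only [List.map_nil]; exact isClosed_const (X := ℕ → ℕ)
      | cons a L ih =>
        intro l
        cases l with
        | nil => simp
        | cons b l =>
          simp only [List.map_cons, List.cons.injEq]
          exact (isClosed_eq (continuous_apply a) continuous_const).inter (ih l)
    exact (h2 _ _).inter h1
  let F : ℕ → List ℕ → α → ℕ := fun n l x => sInf {k | x ∈ C n l k}
  have hF : ∀ n l, Measurable[um α] (F n l) := by
    intro n l
    refine @measurable_to_countable' _ _ _ _ (um α) _ fun k => ?_
    have : F n l ⁻¹' {k} = (C n l k \ ⋃ j : Fin k, C n l j) ∪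
        (if k = 0 then (⋃ j, C n l j)ᶜ else ∅) := by
      ext x
      simp only [Set.mem_preimage, Set.mem_singleton_iff, Set.mem_union, Set.mem_sdiff,
        Set.mem_iUnion, not_exists]
      constructor
      · intro h
        by_cases hne : {k | x ∈ C n l k}.Nonempty
        · left
          have h1 := Nat.sInf_mem hne
          change F n l x ∈ _ at h1
          rw [h] at h1
          refine ⟨h1, fun j hj => ?_⟩
          have := Nat.sInf_le (s := {k | x ∈ C n l k}) hj
          change F n l x ≤ _ at this
          omega
        · right
          rw [Set.not_nonempty_iff_eq_empty] at hne
          have : F n l x = 0 := by simp only [F, hne, Nat.sInf_empty]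
          rw [← h, if_pos this]
          simp only [Set.mem_compl_iff, Set.mem_iUnion, not_exists]
          intro j hj
          have : j ∈ {k | x ∈ C n l k} := hj
          simp [hne] at this
      · rintro (⟨h1, h2⟩ | h)
        · refine le_antisymm (Nat.sInf_le h1) ?_
          by_contra! hlt
          have := Nat.sInf_mem (s := {k | x ∈ C n l k}) ⟨k, h1⟩
          exact h2 ⟨_, hlt⟩ this
        · split_ifs at h with hk
          · simp only [Set.mem_compl_iff, Set.mem_iUnion, not_exists] at h
            simp only [F, hk]
            rw [Nat.sInf_eq_zero]
            right
            ext j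
            simpa using h j
          · simp at h
    rw [this]
    refine MeasurableSet.union ((hC n l k).diff (.iUnion fun j => hC n l j)) ?_
    split_ifs
    · exact (MeasurableSet.iUnion fun j => hC n l j).compl
    · exact @MeasurableSet.empty _ (um α)
  let S : ℕ → α → List ℕ := fun n x => Nat.rec [] (fun n l => l ++ [F n l x]) n
  let s : α → ℕ → ℕ := fun x n => F n (S n x) x
  let _ : MeasurableSpace (List ℕ) := ⊤
  have : DiscreteMeasurableSpace (List ℕ) := ⟨fun _ => trivial⟩
  have hcomp : ∀ (δ : Type) [MeasurableSpace δ] (n : ℕ) (G : List ℕ → α → δ),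
      Measurable[um α] (S n) → (∀ l, Measurable[um α] (G l)) →
      Measurable[um α] fun x => G (S n x) x := by
    intro δ _ n G hS hG t ht
    have : (fun x => G (S n x) x) ⁻¹' t = ⋃ l, (S n ⁻¹' {l} ∩ G l ⁻¹' t) := by
      ext x; simp
    rw [this]
    exact MeasurableSet.iUnion fun l =>
      (hS (MeasurableSet.of_discrete)).inter (hG l ht)
  have hS : ∀ n, Measurable[um α] (S n) := by
    intro n
    induction n with
    | zero => exact @measurable_const _ _ _ (um α) []
    | succ n ih =>
      exact hcomp _ n (fun l x => l ++ [F n l x]) ih fun l =>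
        (measurable_from_top (f := fun k : ℕ => l ++ [k])).comp (hF n l)
  have hSs : ∀ n x, S n x = (List.range n).map (s x) := by
    intro n x
    induction n with
    | zero => rfl
    | succ n ih =>
      rw [List.range_succ, List.map_append, ← ih]
      rfl
  refine ⟨s, @measurable_pi_lambda _ _ _ (um α) _ _ fun n => hcomp _ n (F n) (hS n) (hF n), ?_⟩
  rintro x ⟨u₀, hu₀⟩
  have hex : ∀ n, ∃ u, (List.range n).map u = S n x ∧ g u = x := by
    intro n
    induction n with
    | zero => exact ⟨u₀, rfl, hu₀⟩
    | succ n ih =>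
      obtain ⟨u, hu, hux⟩ := ih
      have hne : {k | x ∈ C n (S n x) k}.Nonempty := ⟨u n, u, ⟨hu, rfl⟩, hux⟩
      obtain ⟨v, ⟨hv1, hv2⟩, hv3⟩ := Nat.sInf_mem hne
      refine ⟨v, ?_, hv3⟩
      rw [List.range_succ, List.map_append, hv1]
      simp only [List.map_cons, List.map_nil, hv2]
      rfl
  choose u hu hux using hex
  have hlim : Tendsto u atTop (𝓝 (s x)) := by
    rw [tendsto_pi_nhds]
    intro i
    refine tendsto_const_nhds.congr' ?_
    filter_upwards [eventually_gt_atTop i] with n hn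
    have h := hu n
    rw [hSs, List.map_inj_left] at h
    exact (h i (List.mem_range.2 hn)).symm
  have h1 := (hg.tendsto (s x)).comp hlim
  refine tendsto_nhds_unique h1 ?_
  simp only [Function.comp_def, hux]
  exact tendsto_const_nhds

end Analytic

lemma analyticSet_prod {α β : Type*} [TopologicalSpace α] [TopologicalSpace β] {s : Set α}
    {t : Set β} (hs : AnalyticSet s) (ht : AnalyticSet t) : AnalyticSet (s ×ˢ t) := by
  obtain ⟨γ, _, _, f, hf, rfl⟩ := analyticSet_iff_exists_polishSpace_range.1 hs
  obtain ⟨δ, _, _, g, hg, rfl⟩ := analyticSet_iff_exists_polishSpace_range.1 ht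
  rw [← Set.range_prodMap]
  exact analyticSet_range_of_polishSpace (hf.prodMap hg)

/-- Jankov–von Neumann uniformization. -/
lemma exists_um_uniformization {α β : Type*} [TopologicalSpace α] [PolishSpace α]
    [MeasurableSpace α] [BorelSpace α] [TopologicalSpace β] [MeasurableSpace β] [BorelSpace β]
    [Nonempty β] {D : Set (α × β)} (hD : AnalyticSet D) :
    ∃ f : α → β, Measurable[um α] f ∧ ∀ x, (∃ y, (x, y) ∈ D) → (x, f x) ∈ D := by
  rw [AnalyticSet] at hD
  rcases hD with rfl | ⟨G, hG, rfl⟩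
  · exact ⟨fun _ => Classical.arbitrary β, @measurable_const _ _ _ (um α) _, by simp⟩
  obtain ⟨s, hs, hsg⟩ := exists_um_rightInverse (continuous_fst.comp hG)
  refine ⟨fun x => (G (s x)).2, (continuous_snd.comp hG).measurable.comp hs, ?_⟩
  rintro x ⟨y, u, hu⟩
  have := hsg x ⟨u, by simp [hu]⟩
  exact ⟨s x, Prod.ext this rfl⟩

section UMKernel

lemma countable_generatePiSystem {β : Type*} {S : Set (Set β)} (hS : S.Countable) :
    (generatePiSystem S).Countable := by
  have h : generatePiSystem S ⊆ (fun l : List (Set β) => l.foldr (· ∩ ·) Set.univ) ''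
      {l | ∀ s ∈ l, s ∈ S} := by
    intro t ht
    induction ht with
    | base h => exact ⟨[_], by simpa using h, by simp⟩
    | inter _ _ _ ih1 ih2 =>
      obtain ⟨l1, h1, rfl⟩ := ih1
      obtain ⟨l2, h2, rfl⟩ := ih2
      refine ⟨l1 ++ l2, fun s hs => (List.mem_append.1 hs).elim (h1 s) (h2 s), ?_⟩
      have : ∀ l : List (Set β), (l ++ l2).foldr (· ∩ ·) Set.univ =
          l.foldr (· ∩ ·) Set.univ ∩ l2.foldr (· ∩ ·) Set.univ := by
        intro l
        induction l with
        | nil => simp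
        | cons a l ih =>
          rw [List.cons_append, List.foldr_cons, ih, List.foldr_cons, Set.inter_assoc]
      exact this l1
  have hc : {l : List (Set β) | ∀ s ∈ l, s ∈ S}.Countable := by
    have : Countable S := hS.to_subtype
    rw [← Set.range_list_map_coe]
    exact Set.countable_range _
  exact (hc.image _).mono h

variable {α β : Type*} [MeasurableSpace α] [MeasurableSpace β]

lemma aemeasurable_um_kernel [MeasurableSpace.CountablyGenerated β] {ν : α → Measure β}
    (hν : Measurable[um α] ν) (hp : ∀ a, IsProbabilityMeasure (ν a)) (μ : Measure α)
    [IsProbabilityMeasure μ] :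
    ∃ κ : Kernel α β, IsMarkovKernel κ ∧ ν =ᵐ[μ] κ := by
  let C := generatePiSystem (MeasurableSpace.countableGeneratingSet β)
  have hC : C.Countable :=
    countable_generatePiSystem MeasurableSpace.countable_countableGeneratingSet
  have hgen : ‹MeasurableSpace β› = .generateFrom C := by
    rw [generateFrom_generatePiSystem_eq, MeasurableSpace.generateFrom_countableGeneratingSet]
  have hCm : ∀ s ∈ C, MeasurableSet s := by
    intro s hs
    rw [hgen]
    exact MeasurableSpace.measurableSet_generateFrom hs
  have hae : ∀ s ∈ C, AEMeasurable (fun a => ν a s) μ := fun s hs =>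
    aemeasurable_of_um ((Measure.measurable_coe (hCm s hs)).comp hν) μ
  have : Countable C := hC.to_subtype
  have hall : ∀ᵐ a ∂μ, ∀ s : C, ν a s = (hae s.1 s.2).mk _ a :=
    ae_all_iff.2 fun s => (hae s.1 s.2).ae_eq_mk
  obtain ⟨a₀⟩ : Nonempty α := μ.nonempty_of_neZero
  let N := toMeasurable μ {a | ¬ ∀ s : C, ν a s = (hae s.1 s.2).mk _ a}
  have hN : MeasurableSet N := measurableSet_toMeasurable _ _
  have hN0 : μ N = 0 := by rw [measure_toMeasurable]; exact hall
  classical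
  let κ : α → Measure β := fun a => if a ∈ N then ν a₀ else ν a
  have hκp : ∀ a, IsProbabilityMeasure (κ a) := fun a => by
    simp only [κ]; split_ifs <;> exact hp _
  have hκ : Measurable κ := by
    refine Measurable.measure_of_isPiSystem_of_isProbabilityMeasure hgen
      (isPiSystem_generatePiSystem _) fun s hs => ?_
    have : (fun a => κ a s) = fun a => if a ∈ N then ν a₀ s else (hae s hs).mk _ a := by
      ext a
      by_cases h : a ∈ N
      · simp [κ, h]
      · have h' : ∀ s : C, ν a s = (hae s.1 s.2).mk _ a := by
          by_contra hcon
          exact h (subset_toMeasurable _ _ hcon)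
        simpa [κ, h] using h' ⟨s, hs⟩
    rw [this]
    exact Measurable.ite hN measurable_const (hae s hs).measurable_mk
  refine ⟨⟨κ, hκ⟩, ⟨hκp⟩, ?_⟩
  have : ∀ᵐ a ∂μ, a ∉ N := measure_eq_zero_iff_ae_notMem.1 hN0
  filter_upwards [this] with a ha
  simp [κ, ha]

lemma aemeasurable_measure_um [MeasurableSpace.CountablyGenerated β] {ν : α → Measure β}
    (hν : Measurable[um α] ν) (hp : ∀ a, IsProbabilityMeasure (ν a)) (μ : Measure α)
    [IsProbabilityMeasure μ] : AEMeasurable ν μ := by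
  obtain ⟨κ, -, h⟩ := aemeasurable_um_kernel hν hp μ
  exact ⟨κ, κ.measurable, h⟩

lemma isProbabilityMeasure_bind_um [MeasurableSpace.CountablyGenerated β] {ν : α → Measure β}
    (hν : Measurable[um α] ν) (hp : ∀ a, IsProbabilityMeasure (ν a)) (μ : Measure α)
    [IsProbabilityMeasure μ] : IsProbabilityMeasure (μ.bind ν) := by
  constructor
  rw [Measure.bind_apply MeasurableSet.univ (aemeasurable_measure_um hν hp μ)]
  simp

lemma lintegral_bind_um [MeasurableSpace.CountablyGenerated β] {ν : α → Measure β}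
    (hν : Measurable[um α] ν) (hp : ∀ a, IsProbabilityMeasure (ν a)) (μ : Measure α)
    [IsProbabilityMeasure μ] {F : β → ℝ≥0∞} (hF : Measurable[um β] F) :
    ∫⁻ b, F b ∂μ.bind ν = ∫⁻ a, ∫⁻ b, F b ∂ν a ∂μ := by
  have := isProbabilityMeasure_bind_um hν hp μ
  exact Measure.lintegral_bind (aemeasurable_measure_um hν hp μ) (aemeasurable_of_um hF _)

lemma measurable_um_lintegral [MeasurableSpace.CountablyGenerated β] {ν : α → Measure β}
    (hν : Measurable[um α] ν) (hp : ∀ a, IsProbabilityMeasure (ν a)) {F : β → ℝ≥0∞}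
    (hF : Measurable[um β] F) : Measurable[um α] fun a => ∫⁻ b, F b ∂ν a := by
  refine measurable_um_of_aemeasurable fun μ hμ => ?_
  have := isProbabilityMeasure_bind_um hν hp μ
  have h1 : AEMeasurable F (Measure.join (μ.map ν)) := aemeasurable_of_um hF (μ.bind ν)
  exact (Measure.aemeasurable_lintegral h1).comp_aemeasurable (aemeasurable_measure_um hν hp μ)

lemma measurable_um_lintegral_prod {ν : α → Measure β}
    (hν : Measurable[um α] ν) (hp : ∀ a, IsProbabilityMeasure (ν a)) {G : α × β → ℝ≥0∞}
    (hG : Measurable G) : Measurable[um α] fun a => ∫⁻ b, G (a, b) ∂ν a := by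
  have key : ∀ {T : Type _} [MeasurableSpace T] {κ : T → Measure β}, Measurable κ →
      (∀ a, IsProbabilityMeasure (κ a)) → ∀ {G : T × β → ℝ≥0∞}, Measurable G →
      Measurable fun a => ∫⁻ b, G (a, b) ∂κ a := by
    intro T _ κ hκ hκp G hG
    let K : Kernel T β := ⟨κ, hκ⟩
    have : IsMarkovKernel K := ⟨hκp⟩
    exact Measurable.lintegral_kernel_prod_right' (κ := K) hG
  refine @key α (um α) ν hν hp G (hG.mono ?_ le_rfl)
  exact sup_le_sup (MeasurableSpace.comap_mono le_um) le_rfl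

/-- The law of `(a, b)` with `b` drawn from `ν a`. -/
def graphM (ν : α → Measure β) (a : α) : Measure (α × β) := (ν a).map (Prod.mk a)

lemma isProbabilityMeasure_graphM {ν : α → Measure β} (hp : ∀ a, IsProbabilityMeasure (ν a))
    (a : α) : IsProbabilityMeasure (graphM ν a) :=
  have := hp a
  Measure.isProbabilityMeasure_map measurable_prodMk_left.aemeasurable

lemma measurable_graphM {ν : α → Measure β} (hν : Measurable[um α] ν)
    (hp : ∀ a, IsProbabilityMeasure (ν a)) : Measurable[um α] (graphM ν) := by
  refine @Measure.measurable_of_measurable_coe _ _ _ (um α) _ fun s hs => ?_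
  have := measurable_um_lintegral_prod hν hp (measurable_one.indicator hs)
  convert this using 2 with a
  rw [graphM, Measure.map_apply measurable_prodMk_left hs,
    ← lintegral_indicator_one (measurable_prodMk_left hs)]
  rfl

lemma measurable_um_apply_section [MeasurableSpace.CountablyGenerated α]
    [MeasurableSpace.CountablyGenerated β] {ν : α → Measure β}
    (hν : Measurable[um α] ν) (hp : ∀ a, IsProbabilityMeasure (ν a)) {D : Set (α × β)}
    (hD : MeasurableSet[um (α × β)] D) :
    Measurable[um α] fun a => ν a (Prod.mk a ⁻¹' D) := by
  have hF : Measurable[um (α × β)] (D.indicator (1 : α × β → ℝ≥0∞)) :=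
    by
    change Measurable[um (α × β)] (D.indicator fun _ => 1)
    exact @Measurable.indicator _ _ _ _ (um (α × β)) _ _ (@measurable_const _ _ _ (um (α × β)) 1) hD
  have := measurable_um_lintegral (measurable_graphM hν hp) (isProbabilityMeasure_graphM hp) hF
  convert this using 2 with a
  have h1 := isProbabilityMeasure_graphM hp a
  have h2 : NullMeasurableSet D (graphM ν a) := hD _ h1
  rw [lintegral_indicator_one₀ h2, graphM,
    Measure.map_apply₀ measurable_prodMk_left.aemeasurable h2]

lemma ae_eq_of_eq_bind_graphM [MeasurableSpace.CountablyGenerated α]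
    [MeasurableSpace.CountablyGenerated β] {ν : α → Measure β}
    (hν : Measurable[um α] ν) (hp : ∀ a, IsProbabilityMeasure (ν a)) {ρ : Measure (α × β)}
    [IsProbabilityMeasure ρ] (hρ : ρ = ρ.fst.bind (graphM ν)) (κ : Kernel α β) [IsMarkovKernel κ]
    (hκ : ρ = ρ.fst ⊗ₘ κ) : ∀ᵐ a ∂ρ.fst, κ a = ν a := by
  obtain ⟨η, hη, hνη⟩ := aemeasurable_um_kernel hν hp ρ.fst
  have h : ρ.fst ⊗ₘ η = ρ.fst ⊗ₘ κ := by
    rw [← hκ]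
    conv_rhs => rw [hρ]
    ext s hs
    rw [Measure.compProd_apply hs, Measure.bind_apply hs
      (aemeasurable_measure_um (measurable_graphM hν hp) (isProbabilityMeasure_graphM hp) _)]
    refine lintegral_congr_ae ?_
    filter_upwards [hνη] with a ha
    rw [graphM, Measure.map_apply measurable_prodMk_left hs, ha]
  have h2 := Kernel.ae_eq_of_compProd_eq h
  filter_upwards [h2, hνη] with a h1 h2
  rw [h2, h1]

end UMKernel

section HistoryLaw

variable {X A : Type*} [MeasurableSpace X] [MeasurableSpace A]

/-- The history `(x_0, a_0, …, x_n)` of a trajectory. -/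
def hist (n : ℕ) (ω : Traj X A) : Hist X A n := (fun i : Fin n => ω i, (ω n).1)

lemma measurable_hist (n : ℕ) : Measurable (hist n : Traj X A → Hist X A n) := by
  unfold hist
  fun_prop

lemma firstState_hist (n : ℕ) (ω : Traj X A) : firstState (hist n ω) = (ω 0).1 := by
  cases n <;> rfl

lemma measurable_firstState (n : ℕ) : Measurable (firstState : Hist X A n → X) := by
  cases n
  · exact measurable_snd
  · unfold firstState
    fun_prop

/-- Append an action and the next state to a history. -/
def snocHist {n : ℕ} (w : (Hist X A n × A) × X) : Hist X A (n + 1) :=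
  (Fin.snoc (α := fun _ => X × A) w.1.1.1 (w.1.1.2, w.1.2), w.2)

lemma measurable_snocHist {n : ℕ} :
    Measurable (snocHist : (Hist X A n × A) × X → Hist X A (n + 1)) := by
  refine Measurable.prodMk (measurable_pi_lambda _ fun i => ?_) measurable_snd
  refine Fin.lastCases ?_ (fun j => ?_) i
  · simp only [Fin.snoc_last]
    fun_prop
  · simp only [Fin.snoc_castSucc]
    fun_prop

/-- Forget the last state of a history. -/
def initHist {n : ℕ} (h : Hist X A (n + 1)) : Hist X A n × A :=
  ((fun i => h.1 i.castSucc, (h.1 (Fin.last n)).1), (h.1 (Fin.last n)).2)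

lemma measurable_initHist {n : ℕ} :
    Measurable (initHist : Hist X A (n + 1) → Hist X A n × A) := by
  unfold initHist
  fun_prop

lemma initHist_snocHist {n : ℕ} (w : (Hist X A n × A) × X) : initHist (snocHist w) = w.1 := by
  simp [initHist, snocHist]

lemma initHist_hist {n : ℕ} (ω : Traj X A) :
    initHist (hist (n + 1) ω) = (hist n ω, (ω n).2) := by
  simp [initHist, hist]

/-- The kernel that extends a history and an action by the next state. -/
def extK (q : Kernel (X × A) X) (n : ℕ) : Kernel (Hist X A n × A) (Hist X A (n + 1)) :=
  (Kernel.id ×ₖ q.comap (fun z : Hist X A n × A => (z.1.2, z.2)) (by fun_prop)).map snocHist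

instance (q : Kernel (X × A) X) [IsMarkovKernel q] (n : ℕ) : IsMarkovKernel (extK q n) :=
  Kernel.IsMarkovKernel.map _ measurable_snocHist

lemma extK_apply (q : Kernel (X × A) X) [IsMarkovKernel q] {n : ℕ} (z : Hist X A n × A) :
    extK q n z = (q (z.1.2, z.2)).map fun y => snocHist (z, y) := by
  rw [extK, Kernel.map_apply _ measurable_snocHist, Kernel.prod_apply, Kernel.id_apply,
    Kernel.comap_apply, Measure.dirac_prod,
    Measure.map_map measurable_snocHist measurable_prodMk_left]
  rfl

lemma map_initHist_extK (q : Kernel (X × A) X) [IsMarkovKernel q] {n : ℕ} (z : Hist X A n × A) :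
    (extK q n z).map initHist = Measure.dirac z := by
  have h1 : Measurable fun y => snocHist (z, y) := measurable_snocHist.comp measurable_prodMk_left
  rw [extK_apply, Measure.map_map measurable_initHist h1]
  have : (initHist ∘ fun y => snocHist (z, y)) = fun _ : X => z :=
    funext fun y => initHist_snocHist (z, y)
  rw [this, Measure.map_const, measure_univ, one_smul]

/-- The laws of the histories generated by an initial law and decision rules `ν`. -/
def histLaw (p0 : Measure X) (q : Kernel (X × A) X) (ν : ∀ n : ℕ, Hist X A n → Measure A) :
    ∀ n : ℕ, Measure (Hist X A n)
  | 0 => p0.map fun x => (Fin.elim0, x)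
  | n + 1 => ((histLaw p0 q ν n).bind (graphM (ν n))).bind (extK q n)

lemma measurable_elim0 : Measurable fun x : X => ((Fin.elim0, x) : Hist X A 0) :=
  Measurable.prodMk (measurable_pi_lambda _ fun i => i.elim0) measurable_id

variable [StandardBorelSpace X] [StandardBorelSpace A]
variable {p0 : Measure X} [IsProbabilityMeasure p0] {q : Kernel (X × A) X} [IsMarkovKernel q]
  {ν : ∀ n : ℕ, Hist X A n → Measure A}

lemma isProbabilityMeasure_histLaw (hν : ∀ n, Measurable[um (Hist X A n)] (ν n))
    (hp : ∀ n h, IsProbabilityMeasure (ν n h)) (n : ℕ) :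
    IsProbabilityMeasure (histLaw p0 q ν n) := by
  induction n with
  | zero => exact Measure.isProbabilityMeasure_map measurable_elim0.aemeasurable
  | succ n ih =>
    have := isProbabilityMeasure_bind_um (measurable_graphM (hν n) (hp n))
      (isProbabilityMeasure_graphM (hp n)) (histLaw p0 q ν n)
    exact isProbabilityMeasure_bind_um (measurable_um (extK q n).measurable)
      (fun _ => inferInstance) _

lemma lintegral_extK {n : ℕ} {F : Hist X A (n + 1) → ℝ≥0∞} (hF : Measurable[um _] F)
    (z : Hist X A n × A) :
    ∫⁻ h, F h ∂extK q n z = ∫⁻ y, F (snocHist (z, y)) ∂q (z.1.2, z.2) := by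
  have h1 : Measurable fun y => snocHist (z, y) := measurable_snocHist.comp measurable_prodMk_left
  rw [extK_apply, lintegral_map' _ h1.aemeasurable]
  have := Measure.isProbabilityMeasure_map (μ := q (z.1.2, z.2)) h1.aemeasurable
  exact aemeasurable_of_um hF _

lemma histInt_eq_lintegral (hν : ∀ n, Measurable[um (Hist X A n)] (ν n))
    (hp : ∀ n h, IsProbabilityMeasure (ν n h)) (n : ℕ) {F : Hist X A n → ℝ≥0∞}
    (hF : Measurable[um (Hist X A n)] F) :
    histInt p0 q ν n F = ∫⁻ h, F h ∂histLaw p0 q ν n := by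
  induction n with
  | zero =>
    rw [histLaw, histInt, lintegral_map' _ measurable_elim0.aemeasurable]
    have := Measure.isProbabilityMeasure_map (μ := p0)
      (measurable_elim0 (X := X) (A := A)).aemeasurable
    exact aemeasurable_of_um hF _
  | succ n ih =>
    have hJ := measurable_graphM (hν n) (hp n)
    have hJp := isProbabilityMeasure_graphM (hp n)
    have hL := isProbabilityMeasure_histLaw (p0 := p0) (q := q) hν hp n
    have := isProbabilityMeasure_bind_um hJ hJp (histLaw p0 q ν n)
    have hE : Measurable[um _] (extK q n) := measurable_um (extK q n).measurable
    have hEF := measurable_um_lintegral hE (fun _ => inferInstance) hF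
    have hG : ∀ h, ∫⁻ z, ∫⁻ k, F k ∂extK q n z ∂graphM (ν n) h =
        ∫⁻ a, ∫⁻ y, F (Fin.snoc h.1 (h.2, a), y) ∂q (h.2, a) ∂ν n h := by
      intro h
      have := hJp h
      have h2 := aemeasurable_of_um hEF (graphM (ν n) h)
      rw [graphM] at h2 ⊢
      rw [lintegral_map' h2 measurable_prodMk_left.aemeasurable]
      refine lintegral_congr fun a => ?_
      rw [lintegral_extK hF]
      rfl
    have hGm := measurable_um_lintegral hJ hJp hEF
    simp only [hG] at hGm
    rw [histLaw, lintegral_bind_um hE (fun _ => inferInstance) _ hF,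
      lintegral_bind_um hJ hJp _ hEF, histInt, ih hGm]
    exact lintegral_congr fun h => (hG h).symm

lemma Policy.measurable_um {Acts : X → Set A} (π : Policy Acts) (n : ℕ) :
    Measurable[um (Hist X A n)] (π.μ n) :=
  @Measure.measurable_of_measurable_coe _ _ _ (um _) _ fun B hB s hs => π.umeas n B hB s hs

lemma induces_iff {Acts : X → Set A} {π : Policy Acts} {p : Measure (Traj X A)} :
    Induces q π p0 p ↔ ∀ n, p.map (hist n) = histLaw p0 q π.μ n := by
  have key : ∀ n (B : Set (Hist X A n)), MeasurableSet B →
      histInt p0 q π.μ n (B.indicator fun _ => 1) = histLaw p0 q π.μ n B := fun n B hB => by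
    rw [histInt_eq_lintegral π.measurable_um π.isProb n
      (PaperStmt.measurable_um (measurable_const.indicator hB))]
    exact lintegral_indicator_one hB
  constructor
  · intro h n
    ext B hB
    rw [Measure.map_apply (measurable_hist n) hB, ← key n B hB]
    exact h n B hB
  · intro h n B hB
    rw [key n B hB, ← h n, Measure.map_apply (measurable_hist n) hB]
    rfl

lemma bind_congr_ae {α β : Type*} [MeasurableSpace α] [MeasurableSpace β] {μ : Measure α}
    {κ η : α → Measure β} (h : ∀ᵐ a ∂μ, κ a = η a) : μ.bind κ = μ.bind η := by
  rw [Measure.bind, Measure.bind, Measure.map_congr h]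

lemma histLaw_congr {ν' : ∀ n : ℕ, Hist X A n → Measure A}
    (h : ∀ n, ∀ᵐ z ∂histLaw p0 q ν n, ν n z = ν' n z) (n : ℕ) :
    histLaw p0 q ν n = histLaw p0 q ν' n := by
  induction n with
  | zero => rfl
  | succ n ih =>
    rw [histLaw, histLaw, ← ih]
    congr 1
    refine bind_congr_ae ?_
    filter_upwards [h n] with z hz
    rw [graphM, graphM, hz]

lemma Induces.congr {Acts : X → Set A} {π π' : Policy Acts} {p : Measure (Traj X A)}
    (hp : Induces q π p0 p) (h : ∀ n, ∀ᵐ z ∂p.map (hist n), π.μ n z = π'.μ n z) :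
    Induces q π' p0 p := by
  rw [induces_iff] at hp ⊢
  intro n
  rw [hp n]
  exact histLaw_congr (fun n => by rw [← hp n]; exact h n) n

/-- The joint law of the history and the next action. -/
lemma Induces.map_hist_action {Acts : X → Set A} {π : Policy Acts} {p : Measure (Traj X A)}
    (hp : Induces q π p0 p) (n : ℕ) :
    p.map (fun ω => (hist n ω, (ω n).2)) = (p.map (hist n)).bind (graphM (π.μ n)) := by
  have hp' := induces_iff.1 hp
  have h1 : (fun ω : Traj X A => (hist n ω, (ω n).2)) = initHist ∘ hist (n + 1) :=
    funext fun ω => (initHist_hist ω).symm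
  rw [h1, ← Measure.map_map measurable_initHist (measurable_hist _), hp' (n + 1), histLaw, hp' n]
  ext s hs
  rw [Measure.map_apply measurable_initHist hs,
    Measure.bind_apply (measurable_initHist hs) (extK q n).measurable.aemeasurable]
  have : ∀ z, extK q n z (initHist ⁻¹' s) = s.indicator 1 z := fun z => by
    rw [← Measure.map_apply measurable_initHist hs, map_initHist_extK, Measure.dirac_apply' _ hs]
  simp_rw [this]
  exact lintegral_indicator_one hs

lemma Induces.map_fst {Acts : X → Set A} {π : Policy Acts} {p : Measure (Traj X A)}
    (hp : Induces q π p0 p) : p.map (fun ω => (ω 0).1) = p0 := by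
  have h := congrArg (Measure.map Prod.snd) (induces_iff.1 hp 0)
  rw [histLaw, Measure.map_map measurable_snd (measurable_hist 0),
    Measure.map_map measurable_snd measurable_elim0] at h
  simpa [Function.comp_def, hist] using h

end HistoryLaw

section Existence

variable {X A : Type*} [MeasurableSpace X] [MeasurableSpace A]

/-- The history and last action determined by the first coordinates of a trajectory. -/
def histOfRestrict (n : ℕ) (z : ∀ _ : Finset.Iic n, X × A) : Hist X A n × A :=
  ((fun i => z ⟨i, Finset.mem_Iic.2 i.2.le⟩, (z ⟨n, Finset.mem_Iic.2 le_rfl⟩).1),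
    (z ⟨n, Finset.mem_Iic.2 le_rfl⟩).2)

lemma measurable_histOfRestrict (n : ℕ) :
    Measurable (histOfRestrict n : (∀ _ : Finset.Iic n, X × A) → Hist X A n × A) := by
  unfold histOfRestrict
  fun_prop

lemma snocHist_hist {n : ℕ} (ω : Traj X A) :
    snocHist ((hist n ω, (ω n).2), (ω (n + 1)).1) = hist (n + 1) ω := by
  refine Prod.ext (funext fun i => ?_) rfl
  refine Fin.lastCases ?_ (fun j => ?_) i
  · simp [snocHist, hist]
  · simp [snocHist, hist]

/-- The transition kernel of the state-action process. -/
def stepK (q : Kernel (X × A) X) (κ : ∀ n, Kernel (Hist X A n) A) (n : ℕ) :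
    Kernel (∀ _ : Finset.Iic n, X × A) (X × A) :=
  (q.comap (fun w : Hist X A n × A => (w.1.2, w.2)) (by fun_prop) ⊗ₖ
    (κ (n + 1)).comap snocHist measurable_snocHist).comap (histOfRestrict n)
      (measurable_histOfRestrict n)

variable {q : Kernel (X × A) X} [IsMarkovKernel q] {κ : ∀ n, Kernel (Hist X A n) A}
  [∀ n, IsMarkovKernel (κ n)]

instance (n : ℕ) : IsMarkovKernel (stepK q κ n) := by
  unfold stepK
  infer_instance

variable (p0 : Measure X) [IsProbabilityMeasure p0] (q κ)

/-- The law of the state-action process with decision kernels `κ`. -/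
def trajLaw : Measure (Traj X A) :=
  Kernel.trajMeasure (X := fun _ => X × A)
    (p0 ⊗ₘ (κ 0).comap (fun x => (Fin.elim0, x)) measurable_elim0) (stepK q κ)

instance : IsProbabilityMeasure (trajLaw q κ p0) := by
  unfold trajLaw
  infer_instance

lemma map_trajLaw_zero : (trajLaw q κ p0).map (fun ω => ω 0) =
    p0 ⊗ₘ (κ 0).comap (fun x => (Fin.elim0, x)) measurable_elim0 := by
  have h1 : (fun ω : Traj X A => ω 0) = MeasurableEquiv.piUnique (fun _ : Finset.Iic 0 => X × A) ∘
      Preorder.frestrictLe (π := fun _ => X × A) 0 := by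
    ext ω <;> rfl
  rw [h1, ← Measure.map_map (by fun_prop) (by fun_prop), trajLaw, Kernel.trajMeasure,
    Measure.map_comp _ _ (by fun_prop), Kernel.traj_map_frestrictLe, Kernel.partialTraj_self,
    Measure.id_comp, Measure.map_map (by fun_prop) (by fun_prop),
    MeasurableEquiv.self_comp_symm, Measure.map_id]

lemma map_hist_action_zero : (trajLaw q κ p0).map (fun ω => (hist 0 ω, (ω 0).2)) =
    (p0.map fun x => (Fin.elim0, x)) ⊗ₘ κ 0 := by
  have h1 : (fun ω : Traj X A => (hist 0 ω, (ω 0).2)) =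
      (fun z : X × A => (((Fin.elim0, z.1) : Hist X A 0), z.2)) ∘ fun ω => ω 0 := by
    funext ω
    refine Prod.ext (Prod.ext (funext fun i => i.elim0) rfl) rfl
  have h2 : Measurable fun z : X × A => (((Fin.elim0, z.1) : Hist X A 0), z.2) :=
    (measurable_elim0.comp measurable_fst).prodMk measurable_snd
  have := Measure.isProbabilityMeasure_map (μ := p0)
      (measurable_elim0 (X := X) (A := A)).aemeasurable
  rw [h1, ← Measure.map_map h2 (measurable_pi_apply 0), map_trajLaw_zero]
  ext s hs
  rw [Measure.map_apply h2 hs, Measure.compProd_apply (h2 hs), Measure.compProd_apply hs,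
    lintegral_map (Kernel.measurable_kernel_prodMk_left hs) measurable_elim0]
  rfl

variable [StandardBorelSpace X] [StandardBorelSpace A]

lemma map_hist_action_succ (n : ℕ) : (trajLaw q κ p0).map (fun ω => (hist (n + 1) ω, (ω (n + 1)).2)) =
    (((trajLaw q κ p0).map (fun ω => (hist n ω, (ω n).2))).bind (extK q n)) ⊗ₘ κ (n + 1) := by
  let s : (∀ _ : Finset.Iic n, X × A) × (X × A) → Hist X A (n + 1) × A := fun z =>
    (snocHist (histOfRestrict n z.1, z.2.1), z.2.2)
  have hs : Measurable s := (measurable_snocHist.comp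
    (((measurable_histOfRestrict n).comp measurable_fst).prodMk (by fun_prop))).prodMk (by fun_prop)
  have h1 : (fun ω : Traj X A => (hist (n + 1) ω, (ω (n + 1)).2)) =
      s ∘ fun ω => (Preorder.frestrictLe (π := fun _ => X × A) n ω, ω (n + 1)) := by
    funext ω
    exact Prod.ext (snocHist_hist ω).symm rfl
  have h2 : (fun ω : Traj X A => (hist n ω, (ω n).2)) =
      histOfRestrict n ∘ Preorder.frestrictLe (π := fun _ => X × A) n := rfl
  have hL : IsProbabilityMeasure ((trajLaw q κ p0).map
      (Preorder.frestrictLe (π := fun _ => X × A) n)) :=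
    Measure.isProbabilityMeasure_map (by fun_prop)
  have hL' := Measure.isProbabilityMeasure_map (μ := (trajLaw q κ p0).map
      (Preorder.frestrictLe (π := fun _ => X × A) n)) (measurable_histOfRestrict n).aemeasurable
  rw [h1, ← Measure.map_map hs (by fun_prop), trajLaw,
    ← Kernel.map_frestrictLe_trajMeasure_compProd_eq_map_trajMeasure, ← trajLaw, h2,
    ← Measure.map_map (measurable_histOfRestrict n) (by fun_prop)]
  ext B hB
  rw [Measure.map_apply hs hB, Measure.compProd_apply (hs hB), Measure.compProd_apply hB,
    Measure.lintegral_bind (extK q n).measurable.aemeasurable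
      (Kernel.measurable_kernel_prodMk_left hB).aemeasurable,
    lintegral_map (Kernel.measurable_kernel_prodMk_left hB).lintegral_kernel
      (measurable_histOfRestrict n)]
  refine lintegral_congr fun z => ?_
  have hz : MeasurableSet (Prod.mk z ⁻¹' (s ⁻¹' B)) := measurable_prodMk_left (hs hB)
  rw [lintegral_extK (measurable_um (Kernel.measurable_kernel_prodMk_left hB)), stepK,
    Kernel.comap_apply, Kernel.compProd_apply hz]
  rfl

/-- Every policy and initial law induce a strategic measure. -/
lemma exists_induces {Acts : X → Set A} (π : Policy Acts) :
    ∃ p : ProbabilityMeasure (Traj X A), Induces q π p0 p.toMeasure := by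
  have hL := isProbabilityMeasure_histLaw (p0 := p0) (q := q) π.measurable_um π.isProb
  choose κ hκ hπκ using fun n => aemeasurable_um_kernel (π.measurable_um n) (π.isProb n)
    (histLaw p0 q π.μ n)
  refine ⟨⟨trajLaw q κ p0, inferInstance⟩, induces_iff.2 fun n => ?_⟩
  rw [histLaw_congr (ν' := fun n => κ n) hπκ]
  change (trajLaw q κ p0).map (hist n) = _
  have hm : ∀ n, Measurable fun ω : Traj X A => (hist n ω, (ω n).2) := fun n =>
    (measurable_hist n).prodMk (by fun_prop)
  have hfst : ∀ n, ((trajLaw q κ p0).map (fun ω => (hist n ω, (ω n).2))).fst =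
      (trajLaw q κ p0).map (hist n) := fun n => by
    rw [Measure.fst, Measure.map_map measurable_fst (hm n)]
    rfl
  have hl : ∀ n, IsProbabilityMeasure ((trajLaw q κ p0).map (hist n)) := fun n =>
    Measure.isProbabilityMeasure_map (measurable_hist n).aemeasurable
  have hJl : ∀ n, IsProbabilityMeasure
      ((trajLaw q κ p0).map (fun ω => (hist n ω, (ω n).2))) := fun n =>
    Measure.isProbabilityMeasure_map (hm n).aemeasurable
  have hJ : ∀ n, (trajLaw q κ p0).map (fun ω => (hist n ω, (ω n).2)) =
      (trajLaw q κ p0).map (hist n) ⊗ₘ κ n := by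
    intro n
    cases n with
    | zero =>
      have := Measure.isProbabilityMeasure_map (μ := p0)
        (measurable_elim0 (X := X) (A := A)).aemeasurable
      rw [← hfst 0, map_hist_action_zero, Measure.fst_compProd]
    | succ n =>
      rw [← hfst (n + 1), map_hist_action_succ]
      have := isProbabilityMeasure_bind_um (measurable_um (extK q n).measurable)
        (fun _ => inferInstance) ((trajLaw q κ p0).map (fun ω => (hist n ω, (ω n).2)))
      rw [Measure.fst_compProd]
  have hg : ∀ n, (trajLaw q κ p0).map (hist n) ⊗ₘ κ n =
      ((trajLaw q κ p0).map (hist n)).bind (graphM (κ n)) := by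
    intro n
    ext s hs
    rw [Measure.compProd_apply hs, Measure.bind_apply hs (aemeasurable_measure_um
      (measurable_graphM (measurable_um (κ n).measurable) fun _ => inferInstance)
      (isProbabilityMeasure_graphM fun _ => inferInstance) _)]
    refine lintegral_congr fun h => ?_
    rw [graphM, Measure.map_apply measurable_prodMk_left hs]
  induction n with
  | zero =>
    have := Measure.isProbabilityMeasure_map (μ := p0)
      (measurable_elim0 (X := X) (A := A)).aemeasurable
    rw [← hfst 0, map_hist_action_zero, Measure.fst_compProd, histLaw]
  | succ n ih =>
    have := isProbabilityMeasure_bind_um (measurable_um (extK q n).measurable)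
        (fun _ => inferInstance) ((trajLaw q κ p0).map (fun ω => (hist n ω, (ω n).2)))
    rw [← hfst (n + 1), map_hist_action_succ, Measure.fst_compProd, hJ, hg, ih, histLaw]

end Existence

section Disintegration

/-- The inclusion of probability measures into measures is Borel measurable for the topology of
weak convergence. -/
lemma measurable_toMeasure_borel {Ω : Type*} [MeasurableSpace Ω] [TopologicalSpace Ω]
    [BorelSpace Ω] [HasOuterApproxClosed Ω] :
    Measurable[borel (ProbabilityMeasure Ω)] (ProbabilityMeasure.toMeasure (Ω := Ω)) := by
  borelize (ProbabilityMeasure Ω)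
  refine Measurable.measure_of_isPiSystem_of_isProbabilityMeasure
    (by rw [BorelSpace.measurable_eq (α := Ω), borel_eq_generateFrom_isClosed])
    isPiSystem_isClosed fun F hF => ?_
  refine measurable_of_tendsto_metrizable (f := fun n (p : ProbabilityMeasure Ω) =>
    ∫⁻ x, IsClosed.apprSeq hF n x ∂p.toMeasure) (fun n => ?_)
    (tendsto_pi_nhds.2 fun p => HasOuterApproxClosed.tendsto_lintegral_apprSeq hF p.toMeasure)
  have h := (ProbabilityMeasure.continuous_testAgainstNN_eval (IsClosed.apprSeq hF n)).measurable
  convert h.coe_nnreal_ennreal using 2 with p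
  exact (FiniteMeasure.testAgainstNN_coe_eq (μ := p.toFiniteMeasure)).symm

lemma measurable_um_prod_le {α β : Type*} [MeasurableSpace α] [MeasurableSpace β] :
    @Prod.instMeasurableSpace α β (um α) ‹_› ≤ um (α × β) :=
  sup_le (measurable_iff_comap_le.1 (measurable_um_um (measurable_um measurable_fst)))
    (measurable_iff_comap_le.1 (measurable_um measurable_snd))

lemma exists_condKernel_family {T Y A : Type*} [MeasurableSpace T] [MeasurableSpace Y]
    [MeasurableSpace.CountablyGenerated Y] [MeasurableSpace A] [StandardBorelSpace A] [Nonempty A]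
    {M : T → Measure (Y × A)} (hM : Measurable M) (hp : ∀ t, IsProbabilityMeasure (M t)) :
    ∃ κ : T × Y → Measure A, Measurable κ ∧ (∀ z, IsProbabilityMeasure (κ z)) ∧
      ∀ t, ∃ K : Kernel Y A, IsMarkovKernel K ∧ M t = (M t).fst ⊗ₘ K ∧ ∀ y, K y = κ (t, y) := by
  let K : Kernel T (Y × A) := ⟨M, hM⟩
  have : IsMarkovKernel K := ⟨hp⟩
  refine ⟨K.condKernel, K.condKernel.measurable, fun z => inferInstance, fun t =>
    ⟨Kernel.sectR K.condKernel t, inferInstance, ?_, fun y => rfl⟩⟩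
  have h := congrArg (fun L : Kernel T (Y × A) => L t) (K.disintegrate K.condKernel)
  simp only [Kernel.compProd_apply_eq_compProd_sectR,
    Kernel.fst_apply] at h
  exact h.symm

lemma exists_um_condKernel_family {T Y A : Type*} [MeasurableSpace T] [MeasurableSpace Y]
    [MeasurableSpace.CountablyGenerated Y] [MeasurableSpace A] [StandardBorelSpace A] [Nonempty A]
    {M : T → Measure (Y × A)} (hM : Measurable[um T] M) (hp : ∀ t, IsProbabilityMeasure (M t)) :
    ∃ κ : T × Y → Measure A, Measurable[um (T × Y)] κ ∧ (∀ z, IsProbabilityMeasure (κ z)) ∧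
      ∀ t, ∃ K : Kernel Y A, IsMarkovKernel K ∧ M t = (M t).fst ⊗ₘ K ∧ ∀ y, K y = κ (t, y) := by
  obtain ⟨κ, hκ, h⟩ := @exists_condKernel_family T Y A (um T) _ _ _ _ _ _ hM hp
  exact ⟨κ, hκ.mono measurable_um_prod_le le_rfl, h⟩

variable {X A : Type*} [MeasurableSpace X] [MeasurableSpace A] [StandardBorelSpace X]
  [StandardBorelSpace A] {q : Kernel (X × A) X} [IsMarkovKernel q] {Y : Type*}
  [MeasurableSpace Y] [MeasurableSpace.CountablyGenerated Y]

lemma bind_graphM_congr_map {α : Type*} [MeasurableSpace α]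
    [MeasurableSpace.CountablyGenerated α] {μ : Measure α}
    [IsProbabilityMeasure μ] {θ : α → Y} (hθ : Measurable θ) {m : Y → Measure A}
    (hm : Measurable[um Y] m) (hmp : ∀ y, IsProbabilityMeasure (m y)) :
    (μ.bind (graphM fun h => m (θ h))).map (Prod.map θ id) = (μ.map θ).bind (graphM m) := by
  have hν : Measurable[um α] fun h => m (θ h) := measurable_um_comp hm (measurable_um hθ)
  have hθ' : Measurable (Prod.map θ (id : A → A)) := hθ.prodMap measurable_id
  have := Measure.isProbabilityMeasure_map (μ := μ) hθ.aemeasurable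
  have hg := measurable_graphM hm hmp
  ext s hs
  rw [Measure.map_apply hθ' hs, Measure.bind_apply (hθ' hs) (aemeasurable_measure_um
    (measurable_graphM hν fun h => hmp _) (isProbabilityMeasure_graphM fun h => hmp _) _),
    Measure.bind_apply hs (aemeasurable_measure_um hg (isProbabilityMeasure_graphM hmp) _),
    lintegral_map' _ hθ.aemeasurable]
  · refine lintegral_congr fun h => ?_
    rw [graphM, graphM, Measure.map_apply measurable_prodMk_left (hθ' hs),
      Measure.map_apply measurable_prodMk_left hs]
    rfl
  · exact aemeasurable_of_um ((Measure.measurable_coe hs).comp hg) _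

/-- If decisions at stage `n` depend on a statistic `θ` of the history through `m`, then `m` is a
conditional law of the action given the statistic. -/
lemma Induces.map_statistic {Acts : X → Set A} {π : Policy Acts} {p0 : Measure X}
    [IsProbabilityMeasure p0] {p : Measure (Traj X A)} [IsProbabilityMeasure p]
    (hp : Induces q π p0 p) {n : ℕ}
    {θ : Hist X A n → Y} (hθ : Measurable θ) {m : Y → Measure A}
    (hm : Measurable[um Y] m) (hmp : ∀ y, IsProbabilityMeasure (m y))
    (hπ : ∀ h, π.μ n h = m (θ h)) :
    p.map (fun ω => (θ (hist n ω), (ω n).2)) =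
      (p.map fun ω => θ (hist n ω)).bind (graphM m) := by
  have hl : IsProbabilityMeasure (p.map (hist n)) :=
    Measure.isProbabilityMeasure_map (measurable_hist n).aemeasurable
  have h1 : (fun ω : Traj X A => (θ (hist n ω), (ω n).2)) =
      Prod.map θ id ∘ fun ω => (hist n ω, (ω n).2) := rfl
  have h2 : π.μ n = fun h => m (θ h) := funext hπ
  rw [h1, ← Measure.map_map (hθ.prodMap measurable_id) ((measurable_hist n).prodMk (by fun_prop)),
    hp.map_hist_action, h2, bind_graphM_congr_map hθ hm hmp,
    Measure.map_map hθ (measurable_hist n)]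
  rfl

end Disintegration

section StatisticKernel

variable {X A : Type*} [MeasurableSpace X] [MeasurableSpace A] [StandardBorelSpace X]
  [StandardBorelSpace A] {q : Kernel (X × A) X} [IsMarkovKernel q] {Y : Type*}
  [MeasurableSpace Y] [MeasurableSpace.CountablyGenerated Y]

lemma measurable_sum_smul_map {T Ω Z ι : Type*} [MeasurableSpace T] [MeasurableSpace Ω]
    [MeasurableSpace Z] [Countable ι] {f : T → Measure Ω} (hf : Measurable f) (w : ι → ℝ≥0∞)
    {ψ : ι → Ω → Z} (hψ : ∀ i, Measurable (ψ i)) :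
    Measurable fun t => Measure.sum fun i => w i • (f t).map (ψ i) := by
  refine Measure.measurable_of_measurable_coe _ fun s hs => ?_
  simp only [Measure.sum_apply _ hs, Measure.smul_apply, smul_eq_mul]
  refine Measurable.tsum fun i => Measurable.const_mul ?_ _
  exact (Measure.measurable_coe hs).comp ((Measure.measurable_map _ (hψ i)).comp hf)

/-- Decision rules that depend on the history only through statistics `θ i` at stages `N i` can be
recovered from the strategic measure, jointly universally measurably in a parameter. -/
lemma exists_statistic_kernel [Nonempty A] {T ι : Type*} [MeasurableSpace T] [Countable ι]
    {f : T → Measure (Traj X A)} (hf : Measurable[um T] f) (hfp : ∀ t, IsProbabilityMeasure (f t))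
    {w : ι → ℝ≥0∞} (hw : ∑' i, w i = 1) (hw0 : ∀ i, w i ≠ 0) (N : ι → ℕ)
    {θ : ∀ i, Hist X A (N i) → Y} (hθ : ∀ i, Measurable (θ i)) :
    ∃ κ : T × Y → Measure A, Measurable[um (T × Y)] κ ∧ (∀ z, IsProbabilityMeasure (κ z)) ∧
      ∀ t (Acts : X → Set A) (π : Policy Acts) (p0 : Measure X), IsProbabilityMeasure p0 →
        Induces q π p0 (f t) → ∀ m : Y → Measure A, Measurable[um Y] m →
        (∀ y, IsProbabilityMeasure (m y)) → (∀ i h, π.μ (N i) h = m (θ i h)) →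
        ∀ i, ∀ᵐ h ∂(f t).map (hist (N i)), κ (t, θ i h) = π.μ (N i) h := by
  let ψ : ∀ i, Traj X A → Y × A := fun i ω => (θ i (hist (N i) ω), (ω (N i)).2)
  have hψ : ∀ i, Measurable (ψ i) := fun i =>
    ((hθ i).comp (measurable_hist _)).prodMk (by fun_prop)
  let M : T → Measure (Y × A) := fun t => Measure.sum fun i => w i • (f t).map (ψ i)
  have hM : Measurable[um T] M := @measurable_sum_smul_map T _ _ ι (um T) _ _ _ f hf w ψ hψ
  have hMp : ∀ t, IsProbabilityMeasure (M t) := fun t => by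
    constructor
    have h1 : ∀ i, ((f t).map (ψ i)) Set.univ = 1 := fun i => by
      rw [Measure.map_apply (hψ i) MeasurableSet.univ, Set.preimage_univ, measure_univ]
    rw [Measure.sum_apply _ MeasurableSet.univ]
    simp only [Measure.smul_apply, h1, smul_eq_mul, mul_one, hw]
  obtain ⟨κ, hκ, hκp, hK⟩ := exists_um_condKernel_family hM hMp
  refine ⟨κ, hκ, hκp, fun t Acts π p0 _ hπ m hm hmp hπm i => ?_⟩
  obtain ⟨K, hKm, hMK, hKκ⟩ := hK t
  have hfst : (M t).fst = Measure.sum fun i => w i • (f t).map fun ω => θ i (hist (N i) ω) := by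
    simp only [M, Measure.fst_sum]
    congr 1
    funext i
    rw [Measure.fst, Measure.map_smul, Measure.map_map measurable_fst (hψ i)]
    rfl
  have hg := measurable_graphM hm hmp
  have hgp := isProbabilityMeasure_graphM hmp
  have hMm : M t = (M t).fst.bind (graphM m) := by
    ext s hs
    rw [Measure.bind_apply hs (aemeasurable_measure_um hg hgp _), hfst, lintegral_sum_measure,
      Measure.sum_apply _ hs]
    refine tsum_congr fun i => ?_
    have : IsProbabilityMeasure ((f t).map fun ω => θ i (hist (N i) ω)) :=
      Measure.isProbabilityMeasure_map ((hθ i).comp (measurable_hist _)).aemeasurable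
    rw [lintegral_smul_measure, Measure.smul_apply, hπ.map_statistic (hθ i) hm hmp (hπm i),
      Measure.bind_apply hs]
    exact aemeasurable_measure_um (μ := (f t).map fun ω => θ i (hist (N i) ω)) hg hgp
  have h1 := ae_eq_of_eq_bind_graphM hm hmp hMm K hMK
  rw [hfst, Measure.ae_sum_iff] at h1
  have h2 := (Measure.ae_ennreal_smul_measure_iff (hw0 i)).1 (h1 i)
  have h3 : (f t).map (fun ω => θ i (hist (N i) ω)) = ((f t).map (hist (N i))).map (θ i) := by
    rw [Measure.map_map (hθ i) (measurable_hist _)]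
    rfl
  rw [h3] at h2
  filter_upwards [ae_of_ae_map (hθ i).aemeasurable h2] with h hh
  rw [← hKκ, hh, hπm]

end StatisticKernel

section Realization

variable {X A : Type*} [TopologicalSpace X] [PolishSpace X] [MeasurableSpace X] [BorelSpace X]
  [TopologicalSpace A] [PolishSpace A] [MeasurableSpace A] [BorelSpace A]
  {q : Kernel (X × A) X} [IsMarkovKernel q] {Acts : X → Set A}

/-- The stationary policy given by a universally measurable selector. -/
def selectorPolicy {g : X → A} (hg : Measurable[um X] g) (hgA : ∀ x, g x ∈ Acts x) :
    Policy Acts where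
  μ _ h := Measure.dirac (g h.2)
  isProb _ _ := inferInstance
  umeas n B hB s hs := by
    have h1 : Measurable[um (Hist X A n)] fun h : Hist X A n => g h.2 :=
      measurable_um_comp hg (measurable_um measurable_snd)
    exact (((Measure.measurable_coe hB).comp Measure.measurable_dirac).comp h1) hs
  feasible _ h := Measure.dirac_apply_of_mem (hgA h.2)

open Classical in
/-- Use the decision rule `κ` for initial states in `G`, where feasible, and the selector `g`
otherwise. -/
def glueRule (Acts : X → Set A) (g : X → A) (G : Set X) {n : ℕ}
    (κ : X × Hist X A n → Measure A) (h : Hist X A n) : Measure A :=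
  if firstState h ∈ G ∧ κ (firstState h, h) (Acts h.2) = 1 then κ (firstState h, h)
  else Measure.dirac (g h.2)

lemma measurable_um_glueRule (hΓ : AnalyticSet {xa : X × A | xa.2 ∈ Acts xa.1}) {g : X → A}
    (hg : Measurable[um X] g) {G : Set X} (hG : MeasurableSet[um X] G) {n : ℕ}
    {κ : X × Hist X A n → Measure A} (hκ : Measurable[um (X × Hist X A n)] κ)
    (hκp : ∀ z, IsProbabilityMeasure (κ z)) :
    Measurable[um (Hist X A n)] (glueRule Acts g G κ) := by
  classical
  have hf : Measurable[um (Hist X A n)] (firstState : Hist X A n → X) :=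
    measurable_um (measurable_firstState n)
  have hpair : Measurable fun h : Hist X A n => (firstState h, h) :=
    (measurable_firstState n).prodMk measurable_id
  have hν : Measurable[um (Hist X A n)] fun h => κ (firstState h, h) :=
    measurable_um_comp hκ (measurable_um hpair)
  have hD : AnalyticSet {z : Hist X A n × A | z.2 ∈ Acts z.1.2} :=
    hΓ.preimage (f := fun z : Hist X A n × A => (z.1.2, z.2)) (by fun_prop)
  have h1 : Measurable[um (Hist X A n)] fun h => κ (firstState h, h) (Acts h.2) :=
    measurable_um_apply_section hν (fun h => hκp _) (AnalyticSet.measurableSet_um hD)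
  have hS : MeasurableSet[um (Hist X A n)]
      {h | firstState h ∈ G ∧ κ (firstState h, h) (Acts h.2) = 1} :=
    @MeasurableSet.inter _ (um _) _ _ (measurable_um_um hf hG) (h1 (measurableSet_singleton 1))
  exact @Measurable.ite _ _ _ _ (um _) _ _ _ hS hν
    (Measure.measurable_dirac.comp (measurable_um_comp hg (measurable_um measurable_snd)))

/-- The policy with decision rules `glueRule`. -/
def gluePolicy (hΓ : AnalyticSet {xa : X × A | xa.2 ∈ Acts xa.1}) {g : X → A}
    (hg : Measurable[um X] g) (hgA : ∀ x, g x ∈ Acts x) {G : Set X}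
    (hG : MeasurableSet[um X] G) {κ : ∀ n, X × Hist X A n → Measure A}
    (hκ : ∀ n, Measurable[um (X × Hist X A n)] (κ n))
    (hκp : ∀ n z, IsProbabilityMeasure (κ n z)) : Policy Acts where
  μ n h := glueRule Acts g G (κ n) h
  isProb n h := by
    have := hκp n
    unfold glueRule
    split_ifs <;> infer_instance
  umeas n B hB s hs :=
    ((Measure.measurable_coe hB).comp (measurable_um_glueRule hΓ hg hG (hκ n) (hκp n))) hs
  feasible n h := by
    unfold glueRule
    split_ifs with hh
    · exact hh.2
    · exact Measure.dirac_apply_of_mem (hgA h.2)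

lemma Induces.ae_firstState {π : Policy Acts} {x : X} {p : Measure (Traj X A)}
    (hp : Induces q π (Measure.dirac x) p) (n : ℕ) :
    ∀ᵐ h ∂p.map (hist n), firstState h = x := by
  have hm : Measurable fun ω : Traj X A => (ω 0).1 := by fun_prop
  have hset : MeasurableSet {h : Hist X A n | firstState h = x} :=
    measurable_firstState n (measurableSet_singleton x)
  rw [ae_map_iff (measurable_hist n).aemeasurable hset]
  simp only [firstState_hist]
  refine ae_of_ae_map (p := fun y => y = x) hm.aemeasurable ?_
  rw [hp.map_fst, ae_dirac_eq]
  rfl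

/-- Strategic measures selected on `G` and recovered by decision rules `κ` are induced by a single
policy, which falls back to a stationary policy outside `G`. -/
lemma exists_realization {C CPol : Policy Acts → Prop}
    (hΓ : AnalyticSet {xa : X × A | xa.2 ∈ Acts xa.1}) {g : X → A}
    (hg : Measurable[um X] g) (hgA : ∀ x, g x ∈ Acts x) (hC : C (selectorPolicy hg hgA))
    {G : Set X} (hG : MeasurableSet[um X] G) (f : X → ProbabilityMeasure (Traj X A))
    {κ : ∀ n, X × Hist X A n → Measure A}
    (hκ : ∀ n, Measurable[um (X × Hist X A n)] (κ n))
    (hκp : ∀ n z, IsProbabilityMeasure (κ n z))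
    (hsel : ∀ x ∈ G, ∃ π : Policy Acts, Induces q π (Measure.dirac x) (f x).toMeasure ∧
      ∀ n, ∀ᵐ h ∂(f x).toMeasure.map (hist n), κ n (x, h) = π.μ n h)
    (hCPol : ∀ π : Policy Acts, (∀ n h, π.μ n h = glueRule Acts g G (κ n) h) → CPol π) :
    ∃ (π : Policy Acts) (R : X → ProbabilityMeasure (Traj X A)), CPol π ∧
      (∀ x, Induces q π (Measure.dirac x) (R x).toMeasure) ∧ (∀ x ∈ G, R x = f x) ∧
      ∀ x ∉ G, R x ∈ tsec q Acts C x := by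
  classical
  choose R0 hR0 using fun x => exists_induces q (Measure.dirac x) (selectorPolicy hg hgA)
  refine ⟨gluePolicy hΓ hg hgA hG hκ hκp, fun x => if x ∈ G then f x else R0 x,
    hCPol _ fun n h => rfl, fun x => ?_, fun x hx => if_pos hx, fun x hx => ?_⟩
  · by_cases hx : x ∈ G
    · simp only [if_pos hx]
      obtain ⟨π, hπ, hae⟩ := hsel x hx
      refine hπ.congr fun n => ?_
      filter_upwards [hπ.ae_firstState n, hae n] with h h1 h2
      change _ = glueRule Acts g G (κ n) h
      rw [glueRule, h1, if_pos ⟨hx, by rw [h2]; exact π.feasible n h⟩, h2]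
    · simp only [if_neg hx]
      refine (hR0 x).congr fun n => ?_
      filter_upwards [(hR0 x).ae_firstState n] with h h1
      change _ = glueRule Acts g G (κ n) h
      rw [glueRule, h1, if_neg fun hh => hx hh.1]
      rfl
  · simp only [if_neg hx]
    exact ⟨⟨_, ⟨Measure.dirac x, inferInstance⟩, hC, hR0 x⟩, (hR0 x).map_fst⟩

end Realization

section PolicyClasses

variable {X A : Type*} [TopologicalSpace X] [PolishSpace X] [MeasurableSpace X] [BorelSpace X]
  [TopologicalSpace A] [PolishSpace A] [MeasurableSpace A] [BorelSpace A]
  {q : Kernel (X × A) X} [IsMarkovKernel q] {Acts : X → Set A}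

/-- Universally measurable selections of strategic measures from the class `C` on universally
measurable sets are induced by single policies in the class `CPol`. -/
def Realizable (q : Kernel (X × A) X) (Acts : X → Set A) (C CPol : Policy Acts → Prop) : Prop :=
  ∀ (G : Set X), MeasurableSet[um X] G → ∀ f : X → ProbabilityMeasure (Traj X A),
    (Measurable[um X] fun x => (f x).toMeasure) → (∀ x ∈ G, f x ∈ tsec q Acts C x) →
    ∃ (π : Policy Acts) (R : X → ProbabilityMeasure (Traj X A)), CPol π ∧
      (∀ x, Induces q π (Measure.dirac x) (R x).toMeasure) ∧ (∀ x ∈ G, R x = f x) ∧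
      ∀ x ∉ G, R x ∈ tsec q Acts C x

lemma exists_um_selector [Nonempty A] (hne : ∀ x, (Acts x).Nonempty)
    (hΓ : AnalyticSet {xa : X × A | xa.2 ∈ Acts xa.1}) :
    ∃ g : X → A, Measurable[um X] g ∧ ∀ x, g x ∈ Acts x := by
  obtain ⟨g, hg, hgA⟩ := exists_um_uniformization hΓ
  exact ⟨g, hg, fun x => hgA x (hne x)⟩

lemma exists_induces_of_mem_tsec {C : Policy Acts → Prop} {x : X}
    {p : ProbabilityMeasure (Traj X A)} (hp : p ∈ tsec q Acts C x) :
    ∃ π : Policy Acts, C π ∧ Induces q π (Measure.dirac x) p.toMeasure := by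
  obtain ⟨⟨π, p0, hC, hπ⟩, hx⟩ := hp
  rw [hπ.map_fst] at hx
  exact ⟨π, hC, hx ▸ hπ⟩

lemma Policy.measurable_um_const_hist [Nonempty A] (π : Policy Acts) (n : ℕ) :
    Measurable[um X] fun y => π.μ n (fun _ => (y, Classical.arbitrary A), y) :=
  measurable_um_comp (π.measurable_um n) (PaperStmt.measurable_um (by fun_prop))

lemma measurable_um_lastState {k : X × X → Measure A} (hk : Measurable[um (X × X)] k) (n : ℕ) :
    Measurable[um (X × Hist X A n)] fun z => k (z.1, z.2.2) :=
  measurable_um_comp hk (measurable_um (by fun_prop))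

lemma realizable_policy [Nonempty A] (hne : ∀ x, (Acts x).Nonempty)
    (hΓ : AnalyticSet {xa : X × A | xa.2 ∈ Acts xa.1}) :
    Realizable q Acts (fun _ => True) fun _ => True := by
  obtain ⟨g, hg, hgA⟩ := exists_um_selector hne hΓ
  intro G hG f hf hfG
  choose κ hκ hκp hκf using fun n => exists_statistic_kernel (q := q) (ι := Unit)
    (w := fun _ => 1) hf (fun x => (f x).2) (by simp) (by simp) (fun _ => n)
    (θ := fun _ (h : Hist X A n) => h) (fun _ => measurable_id)
  refine exists_realization hΓ hg hgA trivial hG f hκ hκp (fun x hx => ?_) fun _ _ => trivial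
  obtain ⟨π, -, hπ⟩ := exists_induces_of_mem_tsec (hfG x hx)
  exact ⟨π, hπ, fun n => hκf n x Acts π _ inferInstance hπ (π.μ n) (π.measurable_um n)
    (π.isProb n) (fun _ _ => rfl) ()⟩

open Classical in
lemma realizable_markov [Nonempty A] (hne : ∀ x, (Acts x).Nonempty)
    (hΓ : AnalyticSet {xa : X × A | xa.2 ∈ Acts xa.1}) :
    Realizable q Acts Policy.Markov Policy.SemiMarkov := by
  obtain ⟨g, hg, hgA⟩ := exists_um_selector hne hΓ
  intro G hG f hf hfG
  choose κ hκ hκp hκf using fun n => exists_statistic_kernel (q := q) (ι := Unit)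
    (w := fun _ => 1) hf (fun x => (f x).2) (by simp) (by simp) (fun _ => n)
    (θ := fun _ (h : Hist X A n) => h.2) (fun _ => measurable_snd)
  refine exists_realization (κ := fun n z => κ n (z.1, z.2.2)) hΓ hg hgA
    ⟨fun _ x => Measure.dirac (g x), fun _ _ => rfl⟩ hG f
    (fun n => measurable_um_lastState (hκ n) n) (fun n z => hκp n _) (fun x hx => ?_) fun π hπ =>
      ⟨fun n z => if z.1 ∈ G ∧ κ n z (Acts z.2) = 1 then κ n z else Measure.dirac (g z.2), hπ⟩
  obtain ⟨π, ⟨m, hm⟩, hπ⟩ := exists_induces_of_mem_tsec (hfG x hx)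
  exact ⟨π, hπ, fun n => hκf n x Acts π _ inferInstance hπ _ (π.measurable_um_const_hist n)
    (fun _ => π.isProb n _) (fun _ _ => by simp only [hm]) ()⟩

open Classical in
lemma realizable_stationary [Nonempty A] (hne : ∀ x, (Acts x).Nonempty)
    (hΓ : AnalyticSet {xa : X × A | xa.2 ∈ Acts xa.1}) :
    Realizable q Acts Policy.Stationary Policy.SemiStationary := by
  obtain ⟨g, hg, hgA⟩ := exists_um_selector hne hΓ
  intro G hG f hf hfG
  obtain ⟨κ, hκ, hκp, hκf⟩ := exists_statistic_kernel (q := q) (ι := ℕ)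
    (w := fun n => 2 ^ (-1 - n : ℤ)) hf (fun x => (f x).2) ENNReal.tsum_two_zpow_neg_add_one
    (fun n => (ENNReal.zpow_pos two_ne_zero ENNReal.ofNat_ne_top _).ne') id
    (θ := fun n (h : Hist X A n) => h.2) (fun _ => measurable_snd)
  refine exists_realization (κ := fun n z => κ (z.1, z.2.2)) hΓ hg hgA
    ⟨fun x => Measure.dirac (g x), fun _ _ => rfl⟩ hG f
    (fun n => measurable_um_lastState hκ n) (fun n z => hκp _) (fun x hx => ?_) fun π hπ =>
      ⟨fun z => if z.1 ∈ G ∧ κ z (Acts z.2) = 1 then κ z else Measure.dirac (g z.2), hπ⟩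
  obtain ⟨π, ⟨m, hm⟩, hπ⟩ := exists_induces_of_mem_tsec (hfG x hx)
  exact ⟨π, hπ, fun n => hκf x Acts π _ inferInstance hπ _ (π.measurable_um_const_hist 0)
    (fun _ => π.isProb 0 _) (fun _ _ => by simp only [hm]) n⟩

end PolicyClasses

section PartialMinimization

variable {X P : Type*} [TopologicalSpace X] {S : X → Set P} {φ : X × P → EReal}

lemma ereal_le_iff_forall_rat {a b : EReal} :
    a ≤ b ↔ ∀ s : ℚ, b < ((s : ℝ) : EReal) → a ≤ ((s : ℝ) : EReal) := by
  refine ⟨fun h s hs => h.trans hs.le, fun h => le_of_not_gt fun hab => ?_⟩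
  obtain ⟨s, hbs, hsa⟩ := EReal.lt_iff_exists_rat_btwn.1 hab
  exact (h s hbs).not_gt hsa

lemma biInf_le_iff_rat {x : X} {b : EReal} :
    ⨅ p ∈ S x, φ (x, p) ≤ b ↔
      ∀ s : ℚ, b < ((s : ℝ) : EReal) → ∃ p ∈ S x, φ (x, p) ≤ ((s : ℝ) : EReal) := by
  rw [ereal_le_iff_forall_rat]
  refine ⟨fun h s hs => ?_, fun h s hs => ?_⟩
  · have h1 : ⨅ p ∈ S x, φ (x, p) < ((s : ℝ) : EReal) :=
      (ereal_le_iff_forall_rat.2 h).trans_lt hs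
    obtain ⟨p, hp, hlt⟩ : ∃ p, ∃ _ : p ∈ S x, φ (x, p) < ((s : ℝ) : EReal) := by
      simpa only [iInf_lt_iff] using h1
    exact ⟨p, hp, hlt.le⟩
  · obtain ⟨p, hp, hle⟩ := h s hs
    exact (biInf_le _ hp).trans hle

variable [TopologicalSpace P]

/-- Partial minimization of a lower semianalytic function is lower semianalytic. -/
lemma lowerSemianalytic_biInf [T2Space X]
    (hφ : ∀ r : ℝ, AnalyticSet {z : X × P | z.2 ∈ S z.1 ∧ φ z ≤ (r : EReal)}) :
    LowerSemianalytic fun x => ⨅ p ∈ S x, φ (x, p) := by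
  intro r
  obtain ⟨s₀, hs₀⟩ := exists_rat_gt r
  have : Nonempty {s : ℚ // r < s} := ⟨⟨s₀, hs₀⟩⟩
  convert AnalyticSet.iInter fun s : {s : ℚ // r < s} =>
    (hφ (s : ℚ)).image_of_continuous continuous_fst using 1
  ext x
  rw [Set.mem_iInter]
  change ⨅ p ∈ S x, φ (x, p) ≤ _ ↔ _
  rw [biInf_le_iff_rat]
  constructor
  · rintro h ⟨s, hs⟩
    obtain ⟨p, hp⟩ := h s (EReal.coe_lt_coe_iff.2 hs)
    exact ⟨(x, p), hp, rfl⟩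
  · intro h s hs
    obtain ⟨⟨y, p⟩, hp, rfl⟩ := h ⟨s, EReal.coe_lt_coe_iff.1 hs⟩
    exact ⟨p, hp⟩

/-- The epigraph of a lower semianalytic function, without the level `⊤`, is analytic. -/
lemma analyticSet_epigraph [T2Space X] [T2Space P]
    (hφ : ∀ r : ℝ, AnalyticSet {z : X × P | z.2 ∈ S z.1 ∧ φ z ≤ (r : EReal)}) :
    AnalyticSet {z : (X × EReal) × P |
      z.2 ∈ S z.1.1 ∧ z.1.2 < ⊤ ∧ φ (z.1.1, z.2) ≤ z.1.2} := by
  have hB : ∀ s r : ℚ, AnalyticSet {b : EReal |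
      b < ((r : ℝ) : EReal) ∧ (b < ((s : ℝ) : EReal) → r ≤ s)} := fun s r => by
    refine MeasurableSet.analyticSet (measurableSet_Iio.inter ?_)
    exact MeasurableSet.imp measurableSet_Iio (MeasurableSet.const _)
  have hc : Continuous fun z : (X × P) × EReal => ((z.1.1, z.2), z.1.2) := by fun_prop
  convert AnalyticSet.iInter fun s : ℚ => AnalyticSet.iUnion fun r : ℚ =>
    (analyticSet_prod (hφ r) (hB s r)).image_of_continuous hc using 1
  ext ⟨⟨x, b⟩, p⟩
  simp only [Set.mem_iInter, Set.mem_iUnion, Set.mem_image]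
  constructor
  · rintro ⟨hp, hb, hle⟩ s
    by_cases hs : b < ((s : ℝ) : EReal)
    · exact ⟨s, ((x, p), b), ⟨⟨hp, hle.trans hs.le⟩, hs, fun _ => le_rfl⟩, rfl⟩
    · obtain ⟨r, hbr, -⟩ := EReal.lt_iff_exists_rat_btwn.1 hb
      exact ⟨r, ((x, p), b), ⟨⟨hp, hle.trans hbr.le⟩, hbr, fun h => absurd h hs⟩, rfl⟩
  · intro h
    have key : ∀ s : ℚ, ∃ r : ℚ, p ∈ S x ∧ φ (x, p) ≤ ((r : ℝ) : EReal) ∧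
        b < ((r : ℝ) : EReal) ∧ (b < ((s : ℝ) : EReal) → r ≤ s) := fun s => by
      obtain ⟨r, ⟨⟨x', p'⟩, b'⟩, ⟨⟨h1, h2⟩, h3, h4⟩, h5⟩ := h s
      simp only [Prod.mk.injEq] at h5
      obtain ⟨⟨rfl, rfl⟩, rfl⟩ := h5
      exact ⟨r, h1, h2, h3, h4⟩
    obtain ⟨r, hp, -, hbr, -⟩ := key 0
    refine ⟨hp, hbr.trans_le le_top, ereal_le_iff_forall_rat.2 fun s hs => ?_⟩
    obtain ⟨r, -, h1, -, h2⟩ := key s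
    exact h1.trans (by exact_mod_cast h2 hs)

variable [PolishSpace X] [MeasurableSpace X] [BorelSpace X]

lemma LowerSemianalytic.measurable_um {v : X → EReal} (hv : LowerSemianalytic v) :
    Measurable[um X] v := by
  refine @measurable_of_Iic EReal X _ _ _ (um X) _ _ _ v fun b => ?_
  have h : v ⁻¹' Set.Iic b = ⋂ s : {s : ℚ // b < ((s : ℝ) : EReal)}, {x | v x ≤ ((s : ℚ) : ℝ)} := by
    ext x
    rw [Set.mem_iInter, Set.mem_preimage, Set.mem_Iic, ereal_le_iff_forall_rat]
    exact ⟨fun h s => h s s.2, fun h s hs => h ⟨s, hs⟩⟩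
  rw [h]
  exact @MeasurableSet.iInter X _ (um X) _ _ fun s => AnalyticSet.measurableSet_um (hv _)

/-- Universally measurable `ε`-optimal selection, optimal where the infimum is attained. -/
lemma exists_um_eps_selector [T2Space P] [MeasurableSpace P] [BorelSpace P] [Nonempty P]
    (hφ : ∀ r : ℝ, AnalyticSet {z : X × P | z.2 ∈ S z.1 ∧ φ z ≤ (r : EReal)})
    {v : X → EReal} (hv : ∀ x, v x = ⨅ p ∈ S x, φ (x, p)) {ε : ℝ} (hε : 0 < ε) :
    ∃ f : X → P, Measurable[um X] f ∧ ∀ x, v x < ⊤ → f x ∈ S x ∧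
      ((∃ p ∈ S x, φ (x, p) = v x) → φ (x, f x) = v x) ∧
      (v x ≠ ⊥ → φ (x, f x) ≤ v x + (ε : EReal)) ∧
      ((¬ ∃ p ∈ S x, φ (x, p) = v x) → v x = ⊥ → φ (x, f x) ≤ ((-ε⁻¹ : ℝ) : EReal)) := by
  classical
  have hle : ∀ x, ∀ p ∈ S x, v x ≤ φ (x, p) := fun x p hp => hv x ▸ biInf_le _ hp
  have hvm : Measurable[um X] v := by
    rw [funext hv]
    exact (lowerSemianalytic_biInf hφ).measurable_um
  have hid : Measurable[um X] fun x : X => x := measurable_um measurable_id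
  have hD := analyticSet_epigraph hφ
  obtain ⟨F, hF, hFD⟩ := exists_um_uniformization hD
  let E : Set X := {x | v x < ⊤ ∧ ∃ p ∈ S x, φ (x, p) = v x}
  have hE : MeasurableSet[um X] E := by
    have h1 : Measurable[um X] fun x => (x, v x) :=
      hid.prodMk hvm
    convert measurable_um_um h1
      (AnalyticSet.measurableSet_um (hD.image_of_continuous continuous_fst)) using 1
    ext x
    constructor
    · rintro ⟨hx, p, hp, h⟩
      exact ⟨((x, v x), p), ⟨hp, hx, h.le⟩, rfl⟩
    · rintro ⟨⟨⟨y, b⟩, p⟩, ⟨hp, hb, h⟩, h2⟩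
      simp only [Prod.mk.injEq] at h2
      obtain ⟨rfl, rfl⟩ := h2
      exact ⟨hb, p, hp, le_antisymm h (hle _ p hp)⟩
  let b : X → EReal := fun x =>
    if x ∈ E then v x else if v x = ⊥ then ((-ε⁻¹ : ℝ) : EReal) else v x + (ε : EReal)
  have hb : Measurable[um X] b := by
    have h1 : Measurable fun y : EReal => y + (ε : EReal) :=
      Monotone.measurable fun _ _ h => add_le_add_left h _
    exact @Measurable.ite _ _ _ _ (um X) _ _ _ hE hvm (@Measurable.ite _ _ _ _ (um X) _ _ _
      (hvm (measurableSet_singleton ⊥)) (@measurable_const _ _ _ (um X) _) (h1.comp hvm))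
  have hxb : Measurable[um X] fun x => (x, b x) :=
    hid.prodMk hb
  have hlt : ∀ x c, v x < c → c < ⊤ → ∃ p, ((x, c), p) ∈ {z : (X × EReal) × P |
      z.2 ∈ S z.1.1 ∧ z.1.2 < ⊤ ∧ φ (z.1.1, z.2) ≤ z.1.2} := fun x c hc hc' => by
    simp only [hv, iInf_lt_iff] at hc
    obtain ⟨p, hp, h⟩ := hc
    exact ⟨p, hp, hc', h.le⟩
  have hmem : ∀ x, v x < ⊤ → ∃ p, ((x, b x), p) ∈ {z : (X × EReal) × P |
      z.2 ∈ S z.1.1 ∧ z.1.2 < ⊤ ∧ φ (z.1.1, z.2) ≤ z.1.2} := fun x hx => by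
    simp only [b]
    split_ifs with h1 h2
    · obtain ⟨-, p, hp, h⟩ := h1
      exact ⟨p, hp, hx, h.le⟩
    · exact hlt x _ (h2 ▸ EReal.bot_lt_coe _) (EReal.coe_lt_top _)
    · refine hlt x _ ?_ (EReal.add_lt_top hx.ne (EReal.coe_ne_top _))
      lift v x to ℝ using ⟨hx.ne, h2⟩ with y
      rw [← EReal.coe_add, EReal.coe_lt_coe_iff]
      linarith
  refine ⟨fun x => F (x, b x), measurable_um_comp hF hxb, fun x hx => ?_⟩
  obtain ⟨h1, -, h3⟩ := hFD _ (hmem x hx)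
  simp only at h1 h3
  refine ⟨h1, fun h => ?_, fun h => ?_, fun h h' => ?_⟩
  · have hxE : x ∈ E := ⟨hx, h⟩
    exact le_antisymm (h3.trans_eq (if_pos hxE)) (hle x _ h1)
  · refine h3.trans ?_
    simp only [b]
    split_ifs
    · exact le_add_of_nonneg_right (by exact_mod_cast hε.le)
    · exact le_rfl
  · have hxE : x ∉ E := fun hxE => h hxE.2
    refine h3.trans_eq ?_
    simp only [b, if_neg hxE, if_pos h']

end PartialMinimization

section Optimization

variable {X A : Type*} [TopologicalSpace X] [PolishSpace X] [MeasurableSpace X] [BorelSpace X]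
  [TopologicalSpace A] [PolishSpace A] [MeasurableSpace A] [BorelSpace A]
  {q : Kernel (X × A) X} {Acts : X → Set A}

lemma Realizable.optConclusion [Nonempty X] [Nonempty A] {C CPol : Policy Acts → Prop}
    (h : Realizable q Acts C CPol) {φ : X × ProbabilityMeasure (Traj X A) → EReal}
    (hφ : LowerSemianalyticOn (tset q Acts C) φ) : OptConclusion q Acts C CPol φ := by
  have hφ' : ∀ r : ℝ, AnalyticSet {z : X × ProbabilityMeasure (Traj X A) |
    z.2 ∈ tsec q Acts C z.1 ∧ φ z ≤ (r : EReal)} := hφ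
  have hv : LowerSemianalytic (phiStar q Acts C φ) := lowerSemianalytic_biInf hφ'
  refine ⟨hv, fun ε hε => ?_⟩
  have : BorelSpace (ProbabilityMeasure (Traj X A)) := ⟨rfl⟩
  have : Nonempty (ProbabilityMeasure (Traj X A)) :=
    ⟨⟨Measure.dirac (Classical.arbitrary _), inferInstance⟩⟩
  obtain ⟨f, hf, hfv⟩ := @exists_um_eps_selector X _ _ _ φ _ _ _ _ _ instMeasProb _ _ hφ'
    (phiStar q Acts C φ) (fun _ => rfl) ε hε
  obtain ⟨π, R, hπ, hR, hRf, hRt⟩ := h {x | phiStar q Acts C φ x < ⊤}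
    (hv.measurable_um measurableSet_Iio) f (measurable_toMeasure_borel.comp hf)
    fun x hx => (hfv x hx).1
  have htop : ∀ x, ¬ phiStar q Acts C φ x < ⊤ → φ (x, R x) = phiStar q Acts C φ x := fun x hx => by
    have h1 : phiStar q Acts C φ x ≤ φ (x, R x) := biInf_le _ (hRt x hx)
    rw [not_lt_top_iff] at hx
    rw [hx] at h1 ⊢
    exact top_le_iff.1 h1
  refine ⟨π, R, hπ, hR, fun x hx => ?_, fun x hx => ?_⟩
  · by_cases hlt : phiStar q Acts C φ x < ⊤
    · rw [hRf x hlt]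
      exact (hfv x hlt).2.1 hx
    · exact htop x hlt
  · have hlt : phiStar q Acts C φ x < ⊤ := by
      by_contra hlt
      exact hx ⟨R x, hRt x hlt, htop x hlt⟩
    rw [hRf x hlt]
    exact ⟨(hfv x hlt).2.2.1, (hfv x hlt).2.2.2 hx⟩

lemma optConclusion_of_isEmpty [IsEmpty X] {C CPol : Policy Acts → Prop}
    (hC : ∀ π : Policy Acts, CPol π) (φ : X × ProbabilityMeasure (Traj X A) → EReal) :
    OptConclusion q Acts C CPol φ := by
  have hH : ∀ n, IsEmpty (Hist X A n) := fun n => inferInstance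
  refine ⟨fun r => ?_, fun ε _ => ⟨⟨fun _ h => (hH _).elim h, fun _ h => (hH _).elim h,
    fun n B _ s _ μ _ => ?_, fun _ h => (hH _).elim h⟩, fun x => isEmptyElim x, hC _,
    fun x => isEmptyElim x, fun x => isEmptyElim x, fun x => isEmptyElim x⟩⟩
  · rw [Set.eq_empty_of_isEmpty {x | phiStar q Acts C φ x ≤ (r : EReal)}]
    exact analyticSet_empty
  · rw [Set.eq_empty_of_isEmpty (_ ⁻¹' s)]
    exact MeasurableSet.empty.nullMeasurableSet

end Optimization

end PaperStmt

namespace PaperStmt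

variable {X A : Type*} [TopologicalSpace X] [PolishSpace X] [MeasurableSpace X] [BorelSpace X]
  [TopologicalSpace A] [PolishSpace A] [MeasurableSpace A] [BorelSpace A]

/-- Theorem `thm-opt`(i)-(ii): for `(S_⋆, Π_⋆)` equal to `(S, Π)`,
`(S_m, Π_sm)` or `(S_s, Π_ss)` and `φ` lower semianalytic on `tilde-S_⋆`, the partial
minimization `φ*` is lower semianalytic, and for each `ε > 0` there is a policy in `Π_⋆`
that is `ε`-optimal and optimal wherever the infimum is attained. -/
theorem statement4
    (q : Kernel (X × A) X) [IsMarkovKernel q] (Acts : X → Set A)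
    (hne : ∀ x, (Acts x).Nonempty)
    (hΓ : MeasureTheory.AnalyticSet {xa : X × A | xa.2 ∈ Acts xa.1})
    (φ : X × ProbabilityMeasure (Traj X A) → EReal) :
    (LowerSemianalyticOn (tset q Acts fun _ => True) φ →
      OptConclusion q Acts (fun _ => True) (fun _ => True) φ) ∧
    (LowerSemianalyticOn (tset q Acts Policy.Markov) φ →
      OptConclusion q Acts Policy.Markov Policy.SemiMarkov φ) ∧
    (LowerSemianalyticOn (tset q Acts Policy.Stationary) φ →
      OptConclusion q Acts Policy.Stationary Policy.SemiStationary φ) := by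
  rcases isEmpty_or_nonempty X with hX | hX
  · have hH : ∀ n, IsEmpty (Hist X A n) := fun n => inferInstance
    exact ⟨fun _ => optConclusion_of_isEmpty (fun _ => trivial) φ,
      fun _ => optConclusion_of_isEmpty
        (fun π => ⟨fun _ z => isEmptyElim z.1, fun n h => (hH n).elim h⟩) φ,
      fun _ => optConclusion_of_isEmpty
        (fun π => ⟨fun z => isEmptyElim z.1, fun n h => (hH n).elim h⟩) φ⟩
  · obtain ⟨x⟩ := id hX
    have : Nonempty A := ⟨(hne x).some⟩
    exact ⟨(realizable_policy hne hΓ).optConclusion, (realizable_markov hne hΓ).optConclusion,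
      (realizable_stationary hne hΓ).optConclusion⟩

end PaperStmt
end
end

section
/- Let c : 𝕏 × 𝔸 → [−∞, +∞] be lower semianalytic, with the convention ∞ − ∞ = −∞ + ∞ = ∞ in all sums and integrals. Then each of the following functions of p ∈ P(Ω) is lower semianalytic: (1) limsup_{n→∞} n^{-1} ∫_Ω Σ_{k=0}^{n-1} c(x_k, a_k) p(dω); (2) the same with liminf; (3) limsup_{n→∞} sup_{j≥0} n^{-1} ∫_Ω Σ_{k=0}^{n-1} c(x_{k+j}, a_{k+j}) p(dω); (4) liminf_{n→∞} inf_{j≥0} of the same integral; and the four pathwise versions ∫_Ω [limsup_{n} n^{-1} Σ_{k=0}^{n-1} c(x_k,a_k)] p(dω), the liminf version, ∫_Ω [limsup_{n} sup_{j≥0} n^{-1} Σ_{k=0}^{n-1} c(x_{k+j},a_{k+j})] p(dω), and the liminf-inf version. -/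
open MeasureTheory ProbabilityTheory Filter
open scoped ENNReal NNReal Topology

noncomputable section

namespace PaperStmt

variable {X A : Type*} [MeasurableSpace X] [MeasurableSpace A]

/-- The partial sum `Σ_{k=0}^{n-1} c(x_{k+j}, a_{k+j})` along a sample path, with the
convention `∞ - ∞ = ∞`. -/
def pathSum (c : X × A → EReal) (n j : ℕ) (ω : Traj X A) : EReal :=
  esum fun k : Fin n => c (ω (k.val + j))

/-- Division by `n` in the extended reals. -/
def avg (n : ℕ) (y : EReal) : EReal := (((n : ℝ)⁻¹ : ℝ) : EReal) * y

/-- `J^(1)`: `limsup_n n⁻¹ E[Σ_{k<n} c(x_k,a_k)]` as a function of the (strategic) measure. -/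
def J1 (c : X × A → EReal) (p : ProbabilityMeasure (Traj X A)) : EReal :=
  limsup (fun n : ℕ => avg n (eint p.toMeasure (pathSum c n 0))) atTop

/-- `J^(2)`: the `liminf` version of `J^(1)`. -/
def J2 (c : X × A → EReal) (p : ProbabilityMeasure (Traj X A)) : EReal :=
  liminf (fun n : ℕ => avg n (eint p.toMeasure (pathSum c n 0))) atTop

/-- `J^(3)`: `limsup_n sup_{j≥0} n⁻¹ E[Σ_{k<n} c(x_{k+j},a_{k+j})]`. -/
def J3 (c : X × A → EReal) (p : ProbabilityMeasure (Traj X A)) : EReal :=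
  limsup (fun n : ℕ => ⨆ j : ℕ, avg n (eint p.toMeasure (pathSum c n j))) atTop

/-- `J^(4)`: `liminf_n inf_{j≥0} n⁻¹ E[Σ_{k<n} c(x_{k+j},a_{k+j})]`. -/
def J4 (c : X × A → EReal) (p : ProbabilityMeasure (Traj X A)) : EReal :=
  liminf (fun n : ℕ => ⨅ j : ℕ, avg n (eint p.toMeasure (pathSum c n j))) atTop

/-- `J̃^(1)`: the pathwise version `E[limsup_n n⁻¹ Σ_{k<n} c(x_k,a_k)]`. -/
def Jt1 (c : X × A → EReal) (p : ProbabilityMeasure (Traj X A)) : EReal :=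
  eint p.toMeasure fun ω => limsup (fun n : ℕ => avg n (pathSum c n 0 ω)) atTop

/-- `J̃^(2)`: the pathwise `liminf` version. -/
def Jt2 (c : X × A → EReal) (p : ProbabilityMeasure (Traj X A)) : EReal :=
  eint p.toMeasure fun ω => liminf (fun n : ℕ => avg n (pathSum c n 0 ω)) atTop

/-- `J̃^(3)`: `E[limsup_n sup_{j≥0} n⁻¹ Σ_{k<n} c(x_{k+j},a_{k+j})]`. -/
def Jt3 (c : X × A → EReal) (p : ProbabilityMeasure (Traj X A)) : EReal :=
  eint p.toMeasure fun ω => limsup (fun n : ℕ => ⨆ j : ℕ, avg n (pathSum c n j ω)) atTop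

/-- `J̃^(4)`: `E[liminf_n inf_{j≥0} n⁻¹ Σ_{k<n} c(x_{k+j},a_{k+j})]`. -/
def Jt4 (c : X × A → EReal) (p : ProbabilityMeasure (Traj X A)) : EReal :=
  eint p.toMeasure fun ω => liminf (fun n : ℕ => ⨅ j : ℕ, avg n (pathSum c n j ω)) atTop

end PaperStmt

namespace PaperStmt

section AnalyticSets

open Set Topology TopologicalSpace

/-- Sequences of natural numbers whose first `n` terms are dominated by those of `β`. -/
def dominatedBelow (β : ℕ → ℕ) (n : ℕ) : Set (ℕ → ℕ) := {α | ∀ i < n, α i ≤ β i}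

theorem dominatedBelow_congr {β β' : ℕ → ℕ} {n : ℕ} (h : ∀ i < n, β i = β' i) :
    dominatedBelow β n = dominatedBelow β' n := by
  ext α
  exact forall₂_congr fun i hi => by rw [h i hi]

theorem antitone_dominatedBelow (β : ℕ → ℕ) : Antitone (dominatedBelow β) :=
  fun _ _ hmn _ hα i hi => hα i (hi.trans_le hmn)

theorem iInter_closure_image_dominatedBelow_subset {Y : Type*} [TopologicalSpace Y]
    [MetrizableSpace Y] {φ : (ℕ → ℕ) → Y} (hφ : Continuous φ) (β : ℕ → ℕ) :
    ⋂ n, closure (φ '' dominatedBelow β n) ⊆ range φ := by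
  let := metrizableSpaceMetric Y
  intro y hy
  have hex : ∀ n : ℕ, ∃ α ∈ dominatedBelow β n, dist y (φ α) < 1 / ((n : ℝ) + 1) := fun n => by
    obtain ⟨_, ⟨α, hα, rfl⟩, h⟩ :=
      Metric.mem_closure_iff.1 (mem_iInter.1 hy n) _ (Nat.one_div_pos_of_nat (n := n))
    exact ⟨α, hα, h⟩
  choose α hα hdist using hex
  have hlim : Tendsto (fun n => φ (α n)) atTop (𝓝 y) := by
    rw [tendsto_iff_dist_tendsto_zero]
    refine squeeze_zero (fun _ => dist_nonneg) (fun n => ?_) tendsto_one_div_add_atTop_nhds_zero_nat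
    rw [dist_comm]
    exact (hdist n).le
  have hcomp : IsCompact (Set.pi univ fun i => Iic (β i)) :=
    isCompact_univ_pi fun i => (finite_Iic (β i)).isCompact
  obtain ⟨a, -, ψ, hψ, ha⟩ := hcomp.tendsto_subseq (x := fun n i => min (α n i) (β i))
    fun n i _ => mem_Iic.2 (min_le_right _ _)
  have ha' : Tendsto (α ∘ ψ) atTop (𝓝 a) := by
    rw [tendsto_pi_nhds] at ha ⊢
    intro i
    refine (ha i).congr' ?_
    filter_upwards [eventually_gt_atTop i] with k hk
    exact min_eq_left (hα _ i (hk.trans_le (hψ.id_le k)))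
  exact ⟨a, tendsto_nhds_unique ((hφ.tendsto a).comp ha') (hlim.comp hψ.tendsto_atTop)⟩

theorem exists_forall_lt_measure_image_dominatedBelow {Y : Type*} [MeasurableSpace Y]
    (μ : Measure Y) (φ : (ℕ → ℕ) → Y) {r : ℝ≥0∞} (hr : r < μ (range φ)) :
    ∃ β, ∀ n, r < μ (φ '' dominatedBelow β n) := by
  have step : ∀ (n : ℕ) (b : ℕ → ℕ), ∃ k, r < μ (φ '' dominatedBelow b n) →
      r < μ (φ '' dominatedBelow (Function.update b n k) (n + 1)) := by
    intro n b
    by_cases hb : r < μ (φ '' dominatedBelow b n)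
    · have hmono : Monotone fun k => φ '' dominatedBelow (Function.update b n k) (n + 1) := by
        intro k l hkl
        refine image_mono fun α hα i hi => (hα i hi).trans ?_
        exact update_le_update_iff.2 ⟨hkl, fun _ _ => le_rfl⟩ i
      have hunion : φ '' dominatedBelow b n =
          ⋃ k, φ '' dominatedBelow (Function.update b n k) (n + 1) := by
        rw [← image_iUnion]
        congr 1
        ext α
        simp only [mem_iUnion]
        constructor
        · intro hα
          refine ⟨α n, fun i hi => ?_⟩
          rcases (Nat.lt_succ_iff_lt_or_eq.1 hi) with h | rfl
          · rw [Function.update_of_ne h.ne]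
            exact hα i h
          · simp
        · rintro ⟨k, hα⟩ i hi
          simpa [Function.update_of_ne hi.ne] using hα i (hi.trans n.lt_succ_self)
      rw [hunion, hmono.measure_iUnion] at hb
      obtain ⟨k, hk⟩ := lt_iSup_iff.1 hb
      exact ⟨k, fun _ => hk⟩
    · exact ⟨0, fun h => absurd h hb⟩
  choose k hk using step
  let b : ℕ → ℕ → ℕ := fun n => Nat.rec 0 (fun n b => Function.update b n (k n b)) n
  have hb : ∀ n, r < μ (φ '' dominatedBelow (b n) n) := by
    intro n
    induction n with
    | zero => simpa [dominatedBelow] using hr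
    | succ n ih => exact hk n (b n) ih
  have hstable : ∀ i n, i < n → b n i = b (i + 1) i := by
    intro i n hi
    induction n, hi using Nat.le_induction with
    | base => rfl
    | succ n hn ih =>
      rw [← ih]
      exact Function.update_of_ne (Nat.ne_of_lt hn) _ _
  refine ⟨fun i => b (i + 1) i, fun n => ?_⟩
  rw [dominatedBelow_congr (β' := b n) fun i hi => (hstable i n hi).symm]
  exact hb n

/-- A finite measure of an analytic set is approximated from within by closed sets. -/
theorem exists_isClosed_subset_le_measure_of_analyticSet {Y : Type*} [TopologicalSpace Y]
    [MetrizableSpace Y] [MeasurableSpace Y] [BorelSpace Y] (μ : Measure Y) [IsFiniteMeasure μ]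
    {s : Set Y} (hs : AnalyticSet s) {r : ℝ≥0∞} (hr : r < μ s) :
    ∃ t ⊆ s, IsClosed t ∧ r ≤ μ t := by
  rw [AnalyticSet] at hs
  obtain rfl | ⟨φ, hφ, rfl⟩ := hs
  · simp at hr
  obtain ⟨β, hβ⟩ := exists_forall_lt_measure_image_dominatedBelow μ φ hr
  refine ⟨_, iInter_closure_image_dominatedBelow_subset hφ β,
    isClosed_iInter fun _ => isClosed_closure, ?_⟩
  have hanti : Antitone fun n => closure (φ '' dominatedBelow β n) :=
    fun _ _ h => closure_mono (image_mono (antitone_dominatedBelow β h))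
  rw [hanti.measure_iInter (fun _ => isClosed_closure.measurableSet.nullMeasurableSet)
    ⟨0, measure_ne_top _ _⟩]
  exact le_iInf fun n => (hβ n).le.trans (measure_mono subset_closure)

theorem nullMeasurableSet_of_analyticSet {Y : Type*} [TopologicalSpace Y]
    [MetrizableSpace Y] [MeasurableSpace Y] [BorelSpace Y] (μ : Measure Y) [IsFiniteMeasure μ]
    {s : Set Y} (hs : AnalyticSet s) : NullMeasurableSet s μ := by
  rcases eq_or_ne (μ s) 0 with h0 | h0
  · exact NullMeasurableSet.of_null h0
  obtain ⟨u, -, hu, hlim⟩ := exists_seq_strictMono_tendsto' (pos_iff_ne_zero.2 h0)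
  choose t hts htc hut using
    fun n => exists_isClosed_subset_le_measure_of_analyticSet μ hs (hu n).2
  have hsub : ⋃ n, t n ⊆ s := iUnion_subset hts
  have hle : μ s ≤ μ (⋃ n, t n) :=
    le_of_tendsto' hlim fun n => (hut n).trans (measure_mono (subset_iUnion t n))
  have hmeas : MeasurableSet (⋃ n, t n) := MeasurableSet.iUnion fun n => (htc n).measurableSet
  exact hmeas.nullMeasurableSet.congr
    (ae_eq_of_subset_of_measure_ge hsub hle hmeas.nullMeasurableSet (measure_ne_top _ _))

/-- A Hausdorff space that is analytic as a subset of itself. -/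
class SuslinSpace (γ : Type*) [TopologicalSpace γ] : Prop extends T2Space γ where
  analyticSet_univ : AnalyticSet (univ : Set γ)

instance suslinSpace_of_polishSpace {γ : Type*} [TopologicalSpace γ]
    [PolishSpace γ] : SuslinSpace γ :=
  ⟨isClosed_univ.analyticSet⟩

section Predicates

variable {γ : Type*} [TopologicalSpace γ] {P Q : γ → Prop}

theorem analyticSet_forall [SuslinSpace γ] {ι : Type*} [Countable ι] {P : ι → γ → Prop}
    (h : ∀ i, AnalyticSet {x | P i x}) : AnalyticSet {x | ∀ i, P i x} := by
  cases isEmpty_or_nonempty ι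
  · simpa using SuslinSpace.analyticSet_univ (γ := γ)
  · simpa [ofPred_forall] using AnalyticSet.iInter h

theorem analyticSet_exists {ι : Type*} [Countable ι] {P : ι → γ → Prop}
    (h : ∀ i, AnalyticSet {x | P i x}) : AnalyticSet {x | ∃ i, P i x} := by
  simpa [ofPred_exists] using AnalyticSet.iUnion h

theorem analyticSet_and [SuslinSpace γ] (hP : AnalyticSet {x | P x}) (hQ : AnalyticSet {x | Q x}) :
    AnalyticSet {x | P x ∧ Q x} := by
  have := analyticSet_forall (P := fun b : Bool => bif b then P else Q)
    (by rintro (_ | _) <;> simpa)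
  simpa [and_comm] using this

theorem analyticSet_or (hP : AnalyticSet {x | P x}) (hQ : AnalyticSet {x | Q x}) :
    AnalyticSet {x | P x ∨ Q x} := by
  have := analyticSet_exists (P := fun b : Bool => bif b then P else Q)
    (by rintro (_ | _) <;> simpa)
  simpa [or_comm] using this

theorem analyticSet_const [SuslinSpace γ] (p : Prop) : AnalyticSet {_x : γ | p} := by
  by_cases hp : p
  · simpa [hp] using SuslinSpace.analyticSet_univ (γ := γ)
  · simpa [hp] using analyticSet_empty

theorem analyticSet_imp [SuslinSpace γ] {p : Prop} (hP : AnalyticSet {x | P x}) :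
    AnalyticSet {x | p → P x} := by
  by_cases hp : p
  · simpa [hp] using hP
  · simpa [hp] using analyticSet_const True

theorem analyticSet_const_and [SuslinSpace γ] {p : Prop} (hP : AnalyticSet {x | P x}) :
    AnalyticSet {x | p ∧ P x} :=
  analyticSet_and (analyticSet_const p) hP

end Predicates

/-- The measure of an analytic set under a weakly continuous family of finite measures is upper
semianalytic. -/
theorem analyticSet_le_measure {T Y : Type*} [TopologicalSpace T] [SuslinSpace T]
    [TopologicalSpace Y] [MetrizableSpace Y] [MeasurableSpace Y] [BorelSpace Y]
    {m : T → FiniteMeasure Y} (hm : Continuous m) {s : Set Y} (hs : AnalyticSet s) (r : ℝ≥0∞) :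
    AnalyticSet {t | r ≤ (m t : Measure Y) s} := by
  rw [AnalyticSet] at hs
  obtain rfl | ⟨φ, hφ, rfl⟩ := hs
  · simpa using analyticSet_const (r = 0)
  have key : ∀ q : ℝ≥0∞, AnalyticSet
      {t | ∃ β, ∀ n, q ≤ (m t : Measure Y) (closure (φ '' dominatedBelow β n))} := by
    intro q
    obtain ⟨Z, _, _, g, hg, hgT⟩ := analyticSet_iff_exists_polishSpace_range.1
      (SuslinSpace.analyticSet_univ (γ := T))
    have hclosed : IsClosed {zβ : Z × (ℕ → ℕ) |
        ∀ n, q ≤ (m (g zβ.1) : Measure Y) (closure (φ '' dominatedBelow zβ.2 n))} := by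
      rw [ofPred_forall]
      refine isClosed_iInter fun n => ?_
      rw [← isOpen_compl_iff, isOpen_iff_mem_nhds]
      rintro ⟨z, β⟩ hz
      simp only [mem_compl_iff, mem_ofPred_eq, not_le] at hz
      have hev₁ : ∀ᶠ z' in 𝓝 z,
          (m (g z') : Measure Y) (closure (φ '' dominatedBelow β n)) < q :=
        eventually_lt_of_limsup_lt ((FiniteMeasure.limsup_measure_closed_le_of_tendsto
          ((hm.comp hg).tendsto z) isClosed_closure).trans_lt hz)
      have hev₂ : ∀ᶠ β' : ℕ → ℕ in 𝓝 β, ∀ i ∈ Finset.range n, β' i = β i := by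
        rw [Filter.eventually_all_finset]
        intro i _
        exact ((continuous_apply i).tendsto β).eventually
          (p := (· = β i)) (by simp [nhds_discrete])
      rw [nhds_prod_eq]
      filter_upwards [hev₁.prod_mk hev₂] with zβ h
      simp only [mem_compl_iff, mem_ofPred_eq, not_le]
      rw [dominatedBelow_congr fun i hi => h.2 i (Finset.mem_range.2 hi)]
      exact h.1
    convert hclosed.analyticSet.image_of_continuous (hg.comp continuous_fst)
    ext t
    constructor
    · rintro ⟨β, h⟩
      obtain ⟨z, rfl⟩ : t ∈ range g := hgT ▸ mem_univ t
      exact ⟨(z, β), h, rfl⟩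
    · rintro ⟨zβ, h, rfl⟩
      exact ⟨zβ.2, h⟩
  have hiff : ∀ t, r ≤ (m t : Measure Y) (range φ) ↔
      ∀ k, denseSeq ℝ≥0∞ k < r → ∃ β, ∀ n, denseSeq ℝ≥0∞ k ≤
        (m t : Measure Y) (closure (φ '' dominatedBelow β n)) := by
    intro t
    constructor
    · intro h k hk
      obtain ⟨β, hβ⟩ := exists_forall_lt_measure_image_dominatedBelow _ φ (hk.trans_le h)
      exact ⟨β, fun n => (hβ n).le.trans (measure_mono subset_closure)⟩
    · intro h
      by_contra! hlt
      obtain ⟨_, ⟨k, rfl⟩, hk₁, hk₂⟩ :=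
        (denseRange_denseSeq ℝ≥0∞).exists_between hlt
      obtain ⟨β, hβ⟩ := h k hk₂
      have hanti : Antitone fun n => closure (φ '' dominatedBelow β n) :=
        fun _ _ h => closure_mono (image_mono (antitone_dominatedBelow β h))
      refine hk₁.not_ge ((le_iInf hβ).trans ?_)
      rw [← hanti.measure_iInter (fun _ => isClosed_closure.measurableSet.nullMeasurableSet)
        ⟨0, measure_ne_top _ _⟩]
      exact measure_mono (iInter_closure_image_dominatedBelow_subset hφ β)
  simp only [hiff]
  exact analyticSet_forall fun k => analyticSet_imp (key _)

theorem SuslinSpace.of_isEmbedding {γ δ : Type*} [TopologicalSpace γ] [TopologicalSpace δ]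
    [T2Space δ] {f : γ → δ} (hf : IsEmbedding f) (h : AnalyticSet (range f)) :
    SuslinSpace γ := by
  have : T2Space γ := hf.t2Space
  obtain ⟨Z, _, _, g, hg, hrange⟩ := analyticSet_iff_exists_polishSpace_range.1 h
  have hex : ∀ z, g z ∈ range f := fun z => hrange ▸ mem_range_self z
  choose u hu using hex
  have hu' : Continuous u := hf.continuous_iff.2 (by rwa [show f ∘ u = g from funext hu])
  refine ⟨?_⟩
  convert analyticSet_range_of_polishSpace hu'
  refine (eq_univ_of_forall fun x => ?_).symm
  obtain ⟨z, hz⟩ : f x ∈ range g := hrange ▸ mem_range_self x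
  exact ⟨z, hf.injective ((hu z).trans hz)⟩

theorem isEmbedding_probabilityMeasure_map {Y K : Type*} [TopologicalSpace Y] [PolishSpace Y]
    [MeasurableSpace Y] [BorelSpace Y] [TopologicalSpace K] [PolishSpace K] [MeasurableSpace K]
    [BorelSpace K] {f : Y → K} (hf : IsEmbedding f) :
    IsEmbedding fun p : ProbabilityMeasure Y => p.map hf.continuous.measurable.aemeasurable := by
  refine ⟨isInducing_iff_nhds.2 fun p => le_antisymm ?_ ?_, fun p p' h => ?_⟩
  · exact (ProbabilityMeasure.continuous_map hf.continuous).continuousAt.tendsto.le_comap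
  · refine tendsto_id'.1 (tendsto_of_forall_isOpen_le_liminf' fun G hG => ?_)
    obtain ⟨V, hV, rfl⟩ := hf.isOpen_iff.1 hG
    have := ProbabilityMeasure.le_liminf_measure_open_of_tendsto
      (tendsto_comap (f := fun p : ProbabilityMeasure Y =>
        p.map hf.continuous.measurable.aemeasurable)
        (x := 𝓝 (p.map hf.continuous.measurable.aemeasurable))) hV
    simpa [Measure.map_apply hf.continuous.measurable hV.measurableSet] using this
  · refine Subtype.ext ((hf.continuous.measurableEmbedding hf.injective).map_injective ?_)
    exact congrArg ProbabilityMeasure.toMeasure h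

instance suslinSpace_probabilityMeasure {Y : Type*} [TopologicalSpace Y] [PolishSpace Y]
    [MeasurableSpace Y] [BorelSpace Y] : SuslinSpace (ProbabilityMeasure Y) := by
  let := upgradeIsCompletelyMetrizable Y
  obtain ⟨f, hf⟩ := Metric.PiNatEmbed.exists_embedding_to_hilbert_cube (X := Y)
  let := metrizableSpaceMetric (ProbabilityMeasure (ℕ → unitInterval))
  have : SecondCountableTopology (ProbabilityMeasure (ℕ → unitInterval)) :=
    UniformSpace.secondCountable_of_separable _
  have : PolishSpace (ProbabilityMeasure (ℕ → unitInterval)) := inferInstance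
  refine .of_isEmbedding (isEmbedding_probabilityMeasure_map hf) ?_
  convert analyticSet_le_measure ProbabilityMeasure.toFiniteMeasure_continuous
    (analyticSet_range_of_polishSpace hf.continuous) 1
  have hfm := hf.continuous.measurableEmbedding hf.injective
  ext p
  constructor
  · rintro ⟨p, rfl⟩
    simp [Measure.map_apply hf.continuous.measurable hfm.measurableSet_range]
  · intro hp
    have hp' : (p : Measure (ℕ → unitInterval)).restrict (range f) = p :=
      Measure.restrict_eq_self_of_ae_mem
        ((mem_ae_iff_prob_eq_one hfm.measurableSet_range).2 (le_antisymm prob_le_one hp))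
    have hmap : ((p : Measure (ℕ → unitInterval)).comap f).map f = p := by
      rw [hfm.map_comap, hp']
    have : IsProbabilityMeasure ((p : Measure (ℕ → unitInterval)).comap f) := by
      refine ⟨?_⟩
      rw [← preimage_univ (f := f), ← Measure.map_apply hf.continuous.measurable .univ, hmap,
        measure_univ]
    exact ⟨⟨_, this⟩, Subtype.ext hmap⟩

/-- All sublevel sets are analytic. -/
def SublevelAnalytic {γ δ : Type*} [TopologicalSpace γ] [LE δ] (f : γ → δ) : Prop :=
  ∀ r, AnalyticSet {x | f x ≤ r}

/-- All superlevel sets are analytic. -/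
def SuperlevelAnalytic {γ δ : Type*} [TopologicalSpace γ] [LE δ] (f : γ → δ) : Prop :=
  ∀ r, AnalyticSet {x | r ≤ f x}

section Linear

variable {γ δ : Type*} [TopologicalSpace γ] [LinearOrder δ] [TopologicalSpace δ]
  [OrderTopology δ] [DenselyOrdered δ] [SeparableSpace δ] {f : γ → δ}

theorem le_iff_forall_denseSeq [Nonempty δ] {a b : δ} :
    a ≤ b ↔ ∀ k, b < denseSeq δ k → a ≤ denseSeq δ k := by
  refine ⟨fun h k hk => h.trans hk.le, fun h => ?_⟩
  by_contra! hlt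
  obtain ⟨_, ⟨k, rfl⟩, h₁, h₂⟩ := (denseRange_denseSeq δ).exists_between hlt
  exact (h k h₁).not_gt h₂

theorem lt_iff_exists_denseSeq [Nonempty δ] {a b : δ} :
    a < b ↔ ∃ k, denseSeq δ k < b ∧ a ≤ denseSeq δ k := by
  refine ⟨fun h => ?_, fun ⟨k, h₁, h₂⟩ => h₂.trans_lt h₁⟩
  obtain ⟨_, ⟨k, rfl⟩, h₁, h₂⟩ := (denseRange_denseSeq δ).exists_between h
  exact ⟨k, h₂, h₁.le⟩

theorem lt_iff_exists_denseSeq' [Nonempty δ] {a b : δ} :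
    a < b ↔ ∃ k, a < denseSeq δ k ∧ denseSeq δ k ≤ b := by
  refine ⟨fun h => ?_, fun ⟨k, h₁, h₂⟩ => h₁.trans_le h₂⟩
  obtain ⟨_, ⟨k, rfl⟩, h₁, h₂⟩ := (denseRange_denseSeq δ).exists_between h
  exact ⟨k, h₁, h₂.le⟩

theorem SublevelAnalytic.lt [SuslinSpace γ] (hf : SublevelAnalytic f) (r : δ) :
    AnalyticSet {x | f x < r} := by
  have : Nonempty δ := ⟨r⟩
  have h : ∀ x, f x < r ↔ _ := fun x => lt_iff_exists_denseSeq
  simp only [h]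
  exact analyticSet_exists fun k => analyticSet_const_and (hf _)

theorem SuperlevelAnalytic.lt [SuslinSpace γ] (hf : SuperlevelAnalytic f) (r : δ) :
    AnalyticSet {x | r < f x} := by
  have : Nonempty δ := ⟨r⟩
  have h : ∀ x, r < f x ↔ _ := fun x => lt_iff_exists_denseSeq'
  simp only [h]
  exact analyticSet_exists fun k => analyticSet_const_and (hf _)

theorem SublevelAnalytic.of_lt [SuslinSpace γ] (hf : ∀ r, AnalyticSet {x | f x < r}) :
    SublevelAnalytic f := by
  intro r
  have : Nonempty δ := ⟨r⟩
  have h : ∀ x, f x ≤ r ↔ ∀ k, r < denseSeq δ k → f x < denseSeq δ k := by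
    refine fun x => ⟨fun h k hk => h.trans_lt hk, fun h => ?_⟩
    exact le_iff_forall_denseSeq.2 fun k hk => (h k hk).le
  simp only [h]
  exact analyticSet_forall fun k => analyticSet_imp (hf _)

theorem SuperlevelAnalytic.of_lt [SuslinSpace γ] (hf : ∀ r, AnalyticSet {x | r < f x}) :
    SuperlevelAnalytic f := by
  intro r
  have : Nonempty δ := ⟨r⟩
  have h : ∀ x, r ≤ f x ↔ ∀ k, denseSeq δ k < r → denseSeq δ k < f x := by
    refine fun x => ⟨fun h k hk => hk.trans_le h, fun h => ?_⟩
    by_contra! hlt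
    obtain ⟨_, ⟨k, rfl⟩, h₁, h₂⟩ := (denseRange_denseSeq δ).exists_between hlt
    exact h₁.not_gt (h k h₂)
  simp only [h]
  exact analyticSet_forall fun k => analyticSet_imp (hf _)

end Linear

theorem SublevelAnalytic.iSup {γ δ ι : Type*} [TopologicalSpace γ] [SuslinSpace γ]
    [CompleteLattice δ] [Countable ι] {f : ι → γ → δ} (hf : ∀ i, SublevelAnalytic (f i)) :
    SublevelAnalytic fun x => ⨆ i, f i x := by
  intro r
  simp only [iSup_le_iff]
  exact analyticSet_forall fun i => hf i r

section CompleteLinear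

variable {γ δ ι : Type*} [TopologicalSpace γ] [SuslinSpace γ] [CompleteLinearOrder δ]
  [TopologicalSpace δ] [OrderTopology δ] [DenselyOrdered δ] [SeparableSpace δ] [Countable ι]

theorem SuperlevelAnalytic.iSup {f : ι → γ → δ} (hf : ∀ i, SuperlevelAnalytic (f i)) :
    SuperlevelAnalytic fun x => ⨆ i, f i x := by
  refine .of_lt fun r => ?_
  simp only [lt_iSup_iff]
  exact analyticSet_exists fun i => (hf i).lt r

theorem SublevelAnalytic.iInf {f : ι → γ → δ} (hf : ∀ i, SublevelAnalytic (f i)) :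
    SublevelAnalytic fun x => ⨅ i, f i x := by
  refine .of_lt fun r => ?_
  simp only [iInf_lt_iff]
  exact analyticSet_exists fun i => (hf i).lt r

theorem SublevelAnalytic.limsup {f : ℕ → γ → δ} (hf : ∀ n, SublevelAnalytic (f n)) :
    SublevelAnalytic fun x => limsup (fun n => f n x) atTop := by
  simp only [limsup_eq_iInf_iSup_of_nat']
  exact .iInf fun n => .iSup fun i => hf (i + n)

theorem SublevelAnalytic.liminf {f : ℕ → γ → δ} (hf : ∀ n, SublevelAnalytic (f n)) :
    SublevelAnalytic fun x => liminf (fun n => f n x) atTop := by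
  simp only [liminf_eq_iSup_iInf_of_nat']
  exact .iSup fun n => .iInf fun i => hf (i + n)

end CompleteLinear

section ENNReal

variable {γ : Type*} [TopologicalSpace γ] [SuslinSpace γ] {a b : γ → ℝ≥0∞}

theorem SublevelAnalytic.add (ha : SublevelAnalytic a) (hb : SublevelAnalytic b) :
    SublevelAnalytic fun x => a x + b x := by
  refine .of_lt fun r => ?_
  have h : ∀ x, a x + b x < r ↔ ∃ k l, denseSeq ℝ≥0∞ k + denseSeq ℝ≥0∞ l < r ∧
      a x ≤ denseSeq ℝ≥0∞ k ∧ b x ≤ denseSeq ℝ≥0∞ l := by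
    refine fun x => ⟨fun h => ?_, fun ⟨k, l, h, hk, hl⟩ => (add_le_add hk hl).trans_lt h⟩
    obtain ⟨y, hy, z, hz, hyz⟩ := ENNReal.exists_add_lt_of_add_lt h
    obtain ⟨k, hk, hk'⟩ := lt_iff_exists_denseSeq.1 hy
    obtain ⟨l, hl, hl'⟩ := lt_iff_exists_denseSeq.1 hz
    exact ⟨k, l, (add_le_add hk.le hl.le).trans_lt hyz, hk', hl'⟩
  simp only [h]
  exact analyticSet_exists fun k => analyticSet_exists fun l =>
    analyticSet_const_and (analyticSet_and (ha _) (hb _))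

theorem SuperlevelAnalytic.add (ha : SuperlevelAnalytic a) (hb : SuperlevelAnalytic b) :
    SuperlevelAnalytic fun x => a x + b x := by
  refine .of_lt fun r => ?_
  have h : ∀ x, r < a x + b x ↔ r < a x ∨ r < b x ∨
      ∃ k l, r < denseSeq ℝ≥0∞ k + denseSeq ℝ≥0∞ l ∧
        denseSeq ℝ≥0∞ k ≤ a x ∧ denseSeq ℝ≥0∞ l ≤ b x := by
    refine fun x => ⟨fun h => ?_, ?_⟩
    · rcases eq_or_ne (a x) 0 with h0 | ha0
      · exact .inr (.inl (by simpa [h0] using h))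
      rcases eq_or_ne (b x) 0 with h0 | hb0
      · exact .inl (by simpa [h0] using h)
      obtain ⟨y, hy, z, hz, hyz⟩ := ENNReal.exists_lt_add_of_lt_add h ha0 hb0
      obtain ⟨k, hk, hk'⟩ := lt_iff_exists_denseSeq'.1 hy
      obtain ⟨l, hl, hl'⟩ := lt_iff_exists_denseSeq'.1 hz
      exact .inr (.inr ⟨k, l, hyz.trans_le (add_le_add hk.le hl.le), hk', hl'⟩)
    · rintro (h | h | ⟨k, l, h, hk, hl⟩)
      · exact h.trans_le le_self_add
      · exact h.trans_le le_add_self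
      · exact h.trans_le (add_le_add hk hl)
  simp only [h]
  exact analyticSet_or (ha.lt r) (analyticSet_or (hb.lt r) (analyticSet_exists fun k =>
    analyticSet_exists fun l => analyticSet_const_and (analyticSet_and (ha _) (hb _))))

theorem SublevelAnalytic.sum {ι : Type*} (s : Finset ι) {f : ι → γ → ℝ≥0∞}
    (hf : ∀ i, SublevelAnalytic (f i)) : SublevelAnalytic fun x => ∑ i ∈ s, f i x := by
  classical
  induction s using Finset.induction_on with
  | empty => exact fun r => by simpa using analyticSet_const True
  | insert i s hi ih => simpa only [Finset.sum_insert hi] using (hf i).add ih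

theorem SuperlevelAnalytic.sum {ι : Type*} (s : Finset ι) {f : ι → γ → ℝ≥0∞}
    (hf : ∀ i, SuperlevelAnalytic (f i)) : SuperlevelAnalytic fun x => ∑ i ∈ s, f i x := by
  classical
  induction s using Finset.induction_on with
  | empty => exact fun r => by simpa using analyticSet_const (r = 0)
  | insert i s hi ih => simpa only [Finset.sum_insert hi] using (hf i).add ih

end ENNReal

theorem SublevelAnalytic.const_mul {γ : Type*} [TopologicalSpace γ] {a : γ → ℝ≥0∞}
    (ha : SublevelAnalytic a) {k : ℝ≥0∞} (h0 : k ≠ 0) (htop : k ≠ ∞) :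
    SublevelAnalytic fun x => k * a x := by
  intro r
  simpa only [mul_comm k, ← ENNReal.le_div_iff_mul_le (.inl h0) (.inl htop)] using ha _

theorem SuperlevelAnalytic.const_mul {γ : Type*} [TopologicalSpace γ] {a : γ → ℝ≥0∞}
    (ha : SuperlevelAnalytic a) {k : ℝ≥0∞} (h0 : k ≠ 0) (htop : k ≠ ∞) :
    SuperlevelAnalytic fun x => k * a x := by
  intro r
  simpa only [mul_comm k, ← ENNReal.div_le_iff h0 htop] using ha _

theorem lowerSemianalytic_iff {γ : Type*} [TopologicalSpace γ] [SuslinSpace γ] {f : γ → EReal} :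
    LowerSemianalytic f ↔ SublevelAnalytic f := by
  refine ⟨fun h r => ?_, fun h r => h r⟩
  induction r with
  | coe r => exact h r
  | top => simpa using analyticSet_const True
  | bot =>
    have : ∀ x, f x ≤ ⊥ ↔ ∀ n : ℕ, f x ≤ ((-n : ℝ) : EReal) := by
      refine fun x => ⟨fun h n => h.trans bot_le, fun h => ?_⟩
      rw [le_bot_iff, EReal.eq_bot_iff_forall_lt]
      intro y
      obtain ⟨n, hn⟩ := exists_nat_gt (-y)
      exact (h n).trans_lt (EReal.coe_lt_coe_iff.2 (by linarith))
    simp only [this]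
    exact analyticSet_forall fun n => h _

section Difference

variable {γ : Type*} [TopologicalSpace γ] [SuslinSpace γ]

theorem SublevelAnalytic.coe_ereal {a : γ → ℝ≥0∞} (ha : SublevelAnalytic a) :
    SublevelAnalytic fun x => (a x : EReal) := by
  intro r
  have h : ∀ x, (a x : EReal) ≤ r ↔ 0 ≤ r ∧ a x ≤ r.toENNReal := by
    refine fun x => ⟨fun h => ⟨(EReal.coe_ennreal_nonneg _).trans h, ?_⟩, fun ⟨h0, h⟩ => ?_⟩
    · simpa using EReal.toENNReal_le_toENNReal h
    · rw [← EReal.coe_toENNReal h0]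
      exact EReal.coe_ennreal_le_coe_ennreal_iff.2 h
  simp only [h]
  exact analyticSet_const_and (ha _)

theorem SuperlevelAnalytic.coe_ereal {γ : Type*} [TopologicalSpace γ] {b : γ → ℝ≥0∞}
    (hb : SuperlevelAnalytic b) : SuperlevelAnalytic fun x => (b x : EReal) := by
  intro r
  have h : ∀ x, r ≤ (b x : EReal) ↔ r.toENNReal ≤ b x := by
    intro x
    rw [← EReal.coe_ennreal_le_coe_ennreal_iff, EReal.coe_toENNReal_eq_max]
    simpa using fun _ => EReal.coe_ennreal_nonneg (b x)
  simp only [h]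
  exact hb _

theorem sublevelAnalytic_sub {a b : γ → ℝ≥0∞} (ha : SublevelAnalytic a)
    (hb : SuperlevelAnalytic b) :
    SublevelAnalytic fun x => if a x = ⊤ then (⊤ : EReal) else (a x : EReal) - (b x : EReal) := by
  rw [← lowerSemianalytic_iff]
  intro r
  have hlt : ∀ (x) (s : ℝ),
      (if a x = ⊤ then (⊤ : EReal) else (a x : EReal) - (b x : EReal)) < s ↔
      ∃ q : ℚ, (a x : EReal) ≤ (q : ℝ) ∧ ((q - s : ℝ) : EReal) < b x := by
    intro x s
    generalize a x = u
    generalize b x = v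
    induction u with
    | top => simp
    | coe u =>
      induction v with
      | top =>
        obtain ⟨q, hq⟩ := exists_rat_gt (u : ℝ)
        simpa using ⟨q, EReal.coe_le_coe_iff.2 hq.le, EReal.coe_lt_top (q - s)⟩
      | coe v =>
        have hcoe : ∀ w : ℝ≥0, ((w : ℝ≥0∞) : EReal) = ((w : ℝ) : EReal) := fun _ => rfl
        simp only [ENNReal.coe_ne_top, if_false, hcoe, ← EReal.coe_sub, EReal.coe_lt_coe_iff,
          EReal.coe_le_coe_iff]
        refine ⟨fun h => ?_, fun ⟨q, h₁, h₂⟩ => by linarith⟩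
        obtain ⟨q, h₁, h₂⟩ := exists_rat_btwn (show (u : ℝ) < s + v by linarith)
        exact ⟨q, h₁.le, by linarith⟩
  have hle : ∀ x, (if a x = ⊤ then (⊤ : EReal) else (a x : EReal) - (b x : EReal)) ≤ r ↔
      ∀ s : ℚ, r < s →
        (if a x = ⊤ then (⊤ : EReal) else (a x : EReal) - (b x : EReal)) < (s : ℝ) := by
    refine fun x => ⟨fun h s hs => h.trans_lt (EReal.coe_lt_coe_iff.2 hs), fun h => ?_⟩
    by_contra! hlt
    obtain ⟨s, hs, hs'⟩ := EReal.lt_iff_exists_rat_btwn.1 hlt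
    exact hs'.not_gt (h s (EReal.coe_lt_coe_iff.1 hs))
  simp only [hle, hlt]
  exact analyticSet_forall fun s => analyticSet_imp (analyticSet_exists fun q =>
    analyticSet_and (ha.coe_ereal _) (hb.coe_ereal.lt _))

theorem SublevelAnalytic.ePos {γ : Type*} [TopologicalSpace γ] {f : γ → EReal}
    (hf : SublevelAnalytic f) :
    SublevelAnalytic fun x => ePos (f x) := by
  have h : ∀ (y : EReal) (r : ℝ≥0∞), PaperStmt.ePos y ≤ r ↔ y ≤ r := by
    intro y r
    change y.toENNReal ≤ r ↔ y ≤ r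
    rw [← EReal.coe_ennreal_le_coe_ennreal_iff, EReal.coe_toENNReal_eq_max]
    simpa using fun _ => EReal.coe_ennreal_nonneg r
  simp only [SublevelAnalytic, h]
  exact fun r => hf r

theorem SublevelAnalytic.superlevelAnalytic_ePos_neg {f : γ → EReal} (hf : SublevelAnalytic f) :
    SuperlevelAnalytic fun x => PaperStmt.ePos (-f x) := by
  have h : ∀ (y : EReal) (r : ℝ≥0∞), r ≤ PaperStmt.ePos (-y) ↔ r = 0 ∨ y ≤ -(r : EReal) := by
    intro y r
    change r ≤ (-y).toENNReal ↔ _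
    rw [← EReal.coe_ennreal_le_coe_ennreal_iff, EReal.coe_toENNReal_eq_max, le_max_iff,
      EReal.le_neg]
    refine or_congr_left ?_
    exact_mod_cast nonpos_iff_eq_zero (a := r)
  simp only [SuperlevelAnalytic, h]
  exact fun r => analyticSet_or (analyticSet_const _) (hf _)

end Difference

section Integral

variable {Y : Type*} [TopologicalSpace Y] [PolishSpace Y] [MeasurableSpace Y] [BorelSpace Y]
  {h : Y → ℝ≥0∞}

theorem SuperlevelAnalytic.aemeasurable (hh : SuperlevelAnalytic h) (μ : Measure Y)
    [IsFiniteMeasure μ] : AEMeasurable h μ :=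
  NullMeasurable.aemeasurable (measurable_of_Ici (δ := NullMeasurableSpace Y μ) fun r =>
    nullMeasurableSet_of_analyticSet μ (hh r))

theorem SublevelAnalytic.aemeasurable (hh : SublevelAnalytic h) (μ : Measure Y)
    [IsFiniteMeasure μ] : AEMeasurable h μ :=
  NullMeasurable.aemeasurable (measurable_of_Iic (δ := NullMeasurableSpace Y μ) fun r =>
    nullMeasurableSet_of_analyticSet μ (hh r))

theorem SuperlevelAnalytic.analyticSet_subgraph {Y : Type*} [TopologicalSpace Y] [PolishSpace Y]
    {h : Y → ℝ≥0∞} (hh : SuperlevelAnalytic h) :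
    AnalyticSet {z : Y × unitInterval | ENNReal.ofReal z.2 ≤ h z.1} := by
  have hle : ∀ z : Y × unitInterval, ENNReal.ofReal z.2 ≤ h z.1 ↔ ∀ k,
      ENNReal.ofReal z.2 ≤ denseSeq ℝ≥0∞ k ∨ denseSeq ℝ≥0∞ k ≤ h z.1 := by
    refine fun z => ⟨fun hz k => (le_total _ _).imp_right fun hk => hk.trans hz, fun hz => ?_⟩
    by_contra! hlt
    obtain ⟨_, ⟨k, rfl⟩, h₁, h₂⟩ := (denseRange_denseSeq ℝ≥0∞).exists_between hlt
    exact (hz k).elim h₂.not_ge h₁.not_ge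
  simp only [hle]
  refine analyticSet_forall fun k => analyticSet_or ?_ ((hh _).preimage continuous_fst)
  exact (isClosed_le (ENNReal.continuous_ofReal.comp (continuous_subtype_val.comp continuous_snd))
    continuous_const).analyticSet

theorem lintegral_eq_measure_subgraph (hh : SuperlevelAnalytic h) (h1 : ∀ y, h y ≤ 1)
    (p : ProbabilityMeasure Y) :
    ∫⁻ y, h y ∂(p : Measure Y) = ((p : Measure Y).prod volume)
      {z : Y × unitInterval | ENNReal.ofReal z.2 ≤ h z.1} := by
  have hnull := nullMeasurableSet_of_analyticSet
    ((p : Measure Y).prod (volume : Measure unitInterval)) hh.analyticSet_subgraph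
  rw [← lintegral_indicator_one₀ hnull,
    lintegral_prod (indicator _ 1) ((aemeasurable_const (b := 1)).indicator₀ hnull)]
  refine lintegral_congr fun y => ?_
  have hfin : h y ≠ ⊤ := ((h1 y).trans_lt ENNReal.one_lt_top).ne
  let t : unitInterval := ⟨(h y).toReal, ENNReal.toReal_nonneg,
    ENNReal.toReal_le_of_le_ofReal zero_le_one (by simpa using h1 y)⟩
  have : ∀ s : unitInterval, ENNReal.ofReal s ≤ h y ↔ s ≤ t := fun s =>
    ENNReal.ofReal_le_iff_le_toReal hfin
  calc h y = volume (Iic t) := by simp [t, hfin]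
    _ = ∫⁻ s, (Iic t).indicator 1 s := (lintegral_indicator_one measurableSet_Iic).symm
    _ = _ := by simp only [indicator, mem_ofPred_eq, mem_Iic, this, Pi.one_apply]

theorem SuperlevelAnalytic.lintegral_of_le_one (hh : SuperlevelAnalytic h) (h1 : ∀ y, h y ≤ 1) :
    SuperlevelAnalytic fun p : ProbabilityMeasure Y => ∫⁻ y, h y ∂(p : Measure Y) := by
  intro r
  let v : ProbabilityMeasure unitInterval := ⟨volume, inferInstance⟩
  have hcont : Continuous fun p : ProbabilityMeasure Y => (p.prod v).toFiniteMeasure :=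
    ProbabilityMeasure.toFiniteMeasure_continuous.comp
      (ProbabilityMeasure.continuous_prod.comp (continuous_id.prodMk continuous_const))
  simp only [lintegral_eq_measure_subgraph hh h1]
  exact analyticSet_le_measure hcont hh.analyticSet_subgraph r

theorem SuperlevelAnalytic.one_sub {γ : Type*} [TopologicalSpace γ] {a : γ → ℝ≥0∞}
    (ha : SuperlevelAnalytic a) : SublevelAnalytic fun x => 1 - a x := by
  intro r
  simpa only [tsub_le_iff_left (b := a _), ← tsub_le_iff_right] using ha (1 - r)

theorem SublevelAnalytic.one_sub {γ : Type*} [TopologicalSpace γ] [SuslinSpace γ] {a : γ → ℝ≥0∞}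
    (ha : SublevelAnalytic a) (h1 : ∀ x, a x ≤ 1) : SuperlevelAnalytic fun x => 1 - a x := by
  intro r
  have h : ∀ x, r ≤ 1 - a x ↔ r ≤ 1 ∧ a x ≤ 1 - r := by
    refine fun x => ⟨fun h => ?_, fun ⟨hr, h⟩ => ?_⟩
    · exact ⟨h.trans tsub_le_self, ENNReal.le_sub_of_add_le_left
        ((h.trans tsub_le_self).trans_lt ENNReal.one_lt_top).ne
        (add_le_of_le_tsub_right_of_le (h1 x) h)⟩
    · exact ENNReal.le_sub_of_add_le_right ((h1 x).trans_lt ENNReal.one_lt_top).ne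
        (add_le_of_le_tsub_left_of_le hr h)
  simp only [h]
  exact analyticSet_const_and (ha _)

theorem SublevelAnalytic.lintegral_of_le_one (hh : SublevelAnalytic h) (h1 : ∀ y, h y ≤ 1) :
    SublevelAnalytic fun p : ProbabilityMeasure Y => ∫⁻ y, h y ∂(p : Measure Y) := by
  have heq : ∀ p : ProbabilityMeasure Y,
      ∫⁻ y, h y ∂(p : Measure Y) = 1 - ∫⁻ y, (1 - h y) ∂(p : Measure Y) := by
    intro p
    have hfin : ∫⁻ y, h y ∂(p : Measure Y) ≤ 1 :=
      (lintegral_mono h1).trans (by simp)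
    rw [lintegral_sub' (hh.aemeasurable _) (hfin.trans_lt ENNReal.one_lt_top).ne (ae_of_all _ h1)]
    simp [ENNReal.sub_sub_cancel ENNReal.one_ne_top hfin]
  simp only [heq]
  exact ((hh.one_sub h1).lintegral_of_le_one fun _ => tsub_le_self).one_sub

theorem lintegral_eq_iSup_mul_lintegral_min {Y : Type*} [MeasurableSpace Y] {h : Y → ℝ≥0∞}
    {μ : Measure Y} (hh : AEMeasurable h μ) :
    ∫⁻ y, h y ∂μ =
      ⨆ n : ℕ, ((n : ℝ≥0∞) + 1) * ∫⁻ y, min (((n : ℝ≥0∞) + 1)⁻¹ * h y) 1 ∂μ := by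
  have hmin : ∀ (n : ℕ) (a : ℝ≥0∞),
      ((n : ℝ≥0∞) + 1) * min (((n : ℝ≥0∞) + 1)⁻¹ * a) 1 = min a (n + 1) := by
    intro n a
    rw [mul_min, ← mul_assoc, ENNReal.mul_inv_cancel (by simp) (by simp), one_mul, mul_one]
  have htop : ⨆ n : ℕ, ((n : ℝ≥0∞) + 1) = ⊤ :=
    top_le_iff.1 (ENNReal.iSup_natCast.symm.trans_le (iSup_mono fun _ => le_self_add))
  have hsup : ∀ a : ℝ≥0∞, ⨆ n : ℕ, min a ((n : ℝ≥0∞) + 1) = a := fun a => by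
    rw [← inf_iSup_eq, htop, inf_top_eq]
  have hint : ∀ n : ℕ, ((n : ℝ≥0∞) + 1) * ∫⁻ y, min (((n : ℝ≥0∞) + 1)⁻¹ * h y) 1 ∂μ =
      ∫⁻ y, min (h y) (n + 1) ∂μ := fun n => by
    rw [← lintegral_const_mul' _ _ (by simp)]
    simp only [hmin]
  simp only [hint]
  rw [← lintegral_iSup' (fun n => hh.min aemeasurable_const)
    (ae_of_all _ fun y m n hmn => by dsimp only; gcongr)]
  simp only [hsup]

theorem SublevelAnalytic.lintegral (hh : SublevelAnalytic h) :
    SublevelAnalytic fun p : ProbabilityMeasure Y => ∫⁻ y, h y ∂(p : Measure Y) := by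
  simp only [fun p : ProbabilityMeasure Y =>
    lintegral_eq_iSup_mul_lintegral_min (hh.aemeasurable (p : Measure Y))]
  refine .iSup fun n => .const_mul (SublevelAnalytic.lintegral_of_le_one (fun r => ?_)
    fun _ => min_le_right _ _) (by simp) (by simp)
  simp only [min_le_iff]
  exact analyticSet_or (hh.const_mul (by simp) (by simp) r) (analyticSet_const _)

theorem SuperlevelAnalytic.lintegral (hh : SuperlevelAnalytic h) :
    SuperlevelAnalytic fun p : ProbabilityMeasure Y => ∫⁻ y, h y ∂(p : Measure Y) := by
  simp only [fun p : ProbabilityMeasure Y =>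
    lintegral_eq_iSup_mul_lintegral_min (hh.aemeasurable (p : Measure Y))]
  refine .iSup fun n => .const_mul (SuperlevelAnalytic.lintegral_of_le_one (fun r => ?_)
    fun _ => min_le_right _ _) (by simp) (by simp)
  simp only [le_min_iff]
  exact analyticSet_and (hh.const_mul (by simp) (by simp) r) (analyticSet_const _)

theorem SublevelAnalytic.eint {f : Y → EReal} (hf : SublevelAnalytic f) :
    SublevelAnalytic fun p : ProbabilityMeasure Y => eint (p : Measure Y) f :=
  sublevelAnalytic_sub hf.ePos.lintegral hf.superlevelAnalytic_ePos_neg.lintegral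

end Integral

theorem SublevelAnalytic.esum {γ : Type*} [TopologicalSpace γ] [SuslinSpace γ] {n : ℕ}
    {v : γ → Fin n → EReal} (hv : ∀ i, SublevelAnalytic fun x => v x i) :
    SublevelAnalytic fun x => esum (v x) :=
  sublevelAnalytic_sub (.sum _ fun i => (hv i).ePos)
    (.sum _ fun i => (hv i).superlevelAnalytic_ePos_neg)

theorem SublevelAnalytic.avg {γ : Type*} [TopologicalSpace γ] [SuslinSpace γ] {f : γ → EReal}
    (hf : SublevelAnalytic f) (n : ℕ) : SublevelAnalytic fun x => avg n (f x) := by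
  intro r
  rcases n.eq_zero_or_pos with rfl | hn
  · simpa [PaperStmt.avg] using analyticSet_const _
  · have hn' : (0 : EReal) < ((n : ℝ) : EReal) := EReal.coe_pos.2 (Nat.cast_pos.2 hn)
    have h : ∀ y, PaperStmt.avg n y ≤ r ↔ y ≤ ((n : ℝ) : EReal) * r := fun y => by
      rw [← EReal.div_le_iff_le_mul hn' (EReal.coe_ne_top _), PaperStmt.avg, EReal.coe_inv,
        mul_comm, EReal.div_eq_inv_mul, mul_comm]
    simp only [h]
    exact hf _

theorem SublevelAnalytic.pathSum {X A : Type*} [TopologicalSpace X] [PolishSpace X]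
    [TopologicalSpace A] [PolishSpace A] {c : X × A → EReal} (hc : SublevelAnalytic c) (n j : ℕ) :
    SublevelAnalytic (pathSum c n j) :=
  .esum fun k r => (hc r).preimage (continuous_apply (k.val + j))

end AnalyticSets

end PaperStmt

namespace PaperStmt

/-- Lemma `lem-ac-lsa`: for a lower semianalytic one-stage cost
`c : 𝕏 × 𝔸 → [−∞,∞]` (with the convention `∞ − ∞ = ∞`), each of the eight average-cost
functionals is lower semianalytic on `P(Ω)`. -/
theorem statement6
    {X A : Type*} [TopologicalSpace X] [PolishSpace X] [MeasurableSpace X] [BorelSpace X]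
    [TopologicalSpace A] [PolishSpace A] [MeasurableSpace A] [BorelSpace A]
    (c : X × A → EReal) (hc : LowerSemianalytic c) :
    LowerSemianalytic (J1 c) ∧ LowerSemianalytic (J2 c) ∧
    LowerSemianalytic (J3 c) ∧ LowerSemianalytic (J4 c) ∧
    LowerSemianalytic (Jt1 c) ∧ LowerSemianalytic (Jt2 c) ∧
    LowerSemianalytic (Jt3 c) ∧ LowerSemianalytic (Jt4 c) := by
  rw [lowerSemianalytic_iff] at hc
  simp only [lowerSemianalytic_iff]
  have hpath : ∀ n j, SublevelAnalytic fun ω : Traj X A => avg n (pathSum c n j ω) :=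
    fun n j => (hc.pathSum n j).avg n
  have hmean : ∀ n j, SublevelAnalytic fun p : ProbabilityMeasure (Traj X A) =>
      avg n (eint p.toMeasure (pathSum c n j)) := fun n j => (hc.pathSum n j).eint.avg n
  exact ⟨.limsup fun n => hmean n 0, .liminf fun n => hmean n 0,
    .limsup fun n => .iSup (hmean n), .liminf fun n => .iInf (hmean n),
    .eint (.limsup fun n => hpath n 0), .eint (.liminf fun n => hpath n 0),
    .eint (.limsup fun n => .iSup (hpath n)), .eint (.liminf fun n => .iInf (hpath n))⟩

end PaperStmt
end
end
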